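/- arXiv:0902.3383 — 2 statements merged into one kernel-verified Lean document; each statement's English description precedes it below -/
import Mathlib

section
/- Carleman estimate for the Dirac operator with convexified logarithmic weight (interior version, Lemma 5.2 of the paper for compactly supported functions): Let Ω ⊆ ℝ³ be a bounded open set, x₀ ∈ ℝ³ ∖ closure(Ω), and let A : ℝ³ → ℝ³ and q : ℝ³ → ℝ be smooth with all derivatives bounded. Then there exist constants C₀ ≥ 1 and C > 0 such that for every α ∈ (0,1) there is h₀ ∈ (0,1) so that for all h ∈ (0,h₀], setting ε(h) = (C₀ α |log h|)⁻¹ and φ̃ = φ + (h/ε(h)) φ²/2 with φ(x) = log|x−x₀|, every u ∈ C_c^∞(Ω; ℂ²) satisfies ∫_Ω e^{2φ̃(x)/h} |u(x)|² dx ≤ C ε(h) ∫_Ω e^{2φ̃(x)/h} |σ·(D+A)u(x) + q(x)u(x)|² dx. -/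
noncomputable section

open MeasureTheory

/-- Euclidean space `ℝ³`. -/
abbrev E3 : Type := EuclideanSpace ℝ (Fin 3)

/-- The Pauli matrices. -/
def σ1 : Matrix (Fin 2) (Fin 2) ℂ := !![0, 1; 1, 0]
def σ2 : Matrix (Fin 2) (Fin 2) ℂ := !![0, -Complex.I; Complex.I, 0]
def σ3 : Matrix (Fin 2) (Fin 2) ℂ := !![1, 0; 0, -1]

/-- `σ·a` for `a ∈ ℂ³`. -/
def pauli (a : Fin 3 → ℂ) : Matrix (Fin 2) (Fin 2) ℂ := a 0 • σ1 + a 1 • σ2 + a 2 • σ3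

/-- Partial derivative `∂ⱼ` of a `ℂ²`-valued function. -/
def pdV (j : Fin 3) (f : E3 → Fin 2 → ℂ) (x : E3) : Fin 2 → ℂ :=
  fderiv ℝ f x (EuclideanSpace.single j 1)

/-- `σ·D u = −i(σ₁∂₁u + σ₂∂₂u + σ₃∂₃u)`. -/
def sigmaD (u : E3 → Fin 2 → ℂ) (x : E3) : Fin 2 → ℂ :=
  (-Complex.I) • (σ1.mulVec (pdV 0 u x) + σ2.mulVec (pdV 1 u x) + σ3.mulVec (pdV 2 u x))

/-- The magnetic Dirac operator `σ·(D+A)u = σ·Du + (σ·A)u`. -/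
def sigmaDA (A : E3 → Fin 3 → ℝ) (u : E3 → Fin 2 → ℂ) (x : E3) : Fin 2 → ℂ :=
  sigmaD u x + (pauli fun j => (A x j : ℂ)).mulVec (u x)

/-- `ε(h) = (C₀ α |log h|)⁻¹`. -/
def carlEps (C₀ α h : ℝ) : ℝ := (C₀ * α * |Real.log h|)⁻¹

/-- The convexified logarithmic weight `φ̃ = φ + (h/ε(h)) φ²/2`, `φ(x) = log|x − x₀|`. -/
def carlPhiT (x₀ : E3) (C₀ α h : ℝ) (x : E3) : ℝ :=
  Real.log ‖x - x₀‖ + (h / carlEps C₀ α h) * (Real.log ‖x - x₀‖) ^ 2 / 2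


def ipV : (Fin 2 → ℂ) →L[ℝ] (Fin 2 → ℂ) →L[ℝ] ℝ :=
  ∑ k : Fin 2,
    ((ContinuousLinearMap.mul ℝ ℝ).bilinearComp
        (Complex.reCLM.comp (ContinuousLinearMap.proj k))
        (Complex.reCLM.comp (ContinuousLinearMap.proj k)) +
     (ContinuousLinearMap.mul ℝ ℝ).bilinearComp
        (Complex.imCLM.comp (ContinuousLinearMap.proj k))
        (Complex.imCLM.comp (ContinuousLinearMap.proj k)))

lemma ipV_apply (a b : Fin 2 → ℂ) : ipV a b =
    (a 0).re * (b 0).re + (a 0).im * (b 0).im + ((a 1).re * (b 1).re + (a 1).im * (b 1).im) := by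
  simp [ipV, Fin.sum_univ_two]

def matJ (l : Fin 3) : Matrix (Fin 2) (Fin 2) ℂ := (-Complex.I) • (![σ1, σ2, σ3] l)

def JV (l : Fin 3) : (Fin 2 → ℂ) →L[ℝ] (Fin 2 → ℂ) :=
  LinearMap.toContinuousLinearMap ((Matrix.mulVecLin (matJ l)).restrictScalars ℝ)

lemma JV_apply (l : Fin 3) (a : Fin 2 → ℂ) : JV l a = (matJ l).mulVec a := rfl

lemma JV0 (a : Fin 2 → ℂ) : JV 0 a = ![-Complex.I * a 1, -Complex.I * a 0] := by
  rw [JV_apply]; ext k; fin_cases k <;> simp [matJ, σ1, Matrix.mulVec, dotProduct, Fin.sum_univ_two]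
lemma JV1 (a : Fin 2 → ℂ) : JV 1 a = ![- a 1, a 0] := by
  rw [JV_apply]; ext k; fin_cases k <;> simp [matJ, σ2, Matrix.mulVec, dotProduct, Fin.sum_univ_two]
lemma JV2 (a : Fin 2 → ℂ) : JV 2 a = ![-Complex.I * a 0, Complex.I * a 1] := by
  rw [JV_apply]; ext k; fin_cases k <;> simp [matJ, σ3, Matrix.mulVec, dotProduct, Fin.sum_univ_two]

lemma ipV_skew (l : Fin 3) (a b : Fin 2 → ℂ) : ipV a (JV l b) = - ipV b (JV l a) := by
  fin_cases l <;> simp [JV0, JV1, JV2, ipV_apply] <;> ring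

lemma ipV_comm (a b : Fin 2 → ℂ) : ipV a b = ipV b a := by
  simp only [ipV_apply]; ring

lemma ipV_nonneg (a : Fin 2 → ℂ) : 0 ≤ ipV a a := by
  simp only [ipV_apply]; nlinarith [sq_nonneg (a 0).re, sq_nonneg (a 0).im, sq_nonneg (a 1).re, sq_nonneg (a 1).im]

lemma ipV_self (a : Fin 2 → ℂ) : ipV a a = ∑ k, ‖a k‖ ^ 2 := by
  simp only [ipV_apply, Fin.sum_univ_two, Complex.sq_norm, Complex.normSq_apply]

def rotM (l : Fin 3) : E3 →L[ℝ] E3 :=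
  LinearMap.toContinuousLinearMap
    { toFun := fun y => (![!₂[0, -y 2, y 1], !₂[y 2, 0, -y 0], !₂[-y 1, y 0, 0]] l : E3)
      map_add' := by
        intro a b; fin_cases l <;> ext i <;> fin_cases i <;> simp <;> ring
      map_smul' := by
        intro a b; fin_cases l <;> ext i <;> fin_cases i <;> simp }

lemma rotM_apply (l : Fin 3) (y : E3) : rotM l y =
   (![!₂[0, -y 2, y 1], !₂[y 2, 0, -y 0], !₂[-y 1, y 0, 0]] l : E3) := rfl

lemma E3_decomp (y : E3) : y = y 0 • EuclideanSpace.single (0 : Fin 3) (1:ℝ)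
    + y 1 • EuclideanSpace.single (1 : Fin 3) (1:ℝ) + y 2 • EuclideanSpace.single (2 : Fin 3) (1:ℝ) := by
  ext i; fin_cases i <;> simp

set_option maxRecDepth 20000 in
set_option maxHeartbeats 1000000 in
lemma alg_sigma (y : E3) (T : E3 →L[ℝ] (Fin 2 → ℂ)) :
    ipV (T y - ∑ l, JV l (T (rotM l y))) (T y - ∑ l, JV l (T (rotM l y))) =
    ((y 0)^2 + (y 1)^2 + (y 2)^2) *
    ∑ k, ‖((-Complex.I) • (σ1.mulVec (T (EuclideanSpace.single 0 1))
      + σ2.mulVec (T (EuclideanSpace.single 1 1)) + σ3.mulVec (T (EuclideanSpace.single 2 1)))) k‖ ^ 2 := by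
  have h : ∀ z : E3, T z = z 0 • T (EuclideanSpace.single 0 1) + z 1 • T (EuclideanSpace.single 1 1)
      + z 2 • T (EuclideanSpace.single 2 1) := by
    intro z
    conv_lhs => rw [E3_decomp z]
    simp only [map_add, map_smul]
  rw [← ipV_self]
  simp only [h y, h (rotM _ y)]
  generalize T (EuclideanSpace.single 0 1) = p
  generalize T (EuclideanSpace.single 1 1) = q
  generalize T (EuclideanSpace.single 2 1) = r
  simp [Fin.sum_univ_three, rotM_apply, JV0, JV1, JV2, ipV_apply, σ1, σ2, σ3, Matrix.mulVec, dotProduct, Fin.sum_univ_two, Matrix.vecHead, Matrix.vecTail]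
  generalize y.ofLp 0 = a
  generalize y.ofLp 1 = b
  generalize y.ofLp 2 = c
  generalize (p 0).re = p0
  generalize (p 0).im = p1
  generalize (p 1).re = p2
  generalize (p 1).im = p3
  generalize (q 0).re = q0
  generalize (q 0).im = q1
  generalize (q 1).re = q2
  generalize (q 1).im = q3
  generalize (r 0).re = r0
  generalize (r 0).im = r1
  generalize (r 1).re = r2
  generalize (r 1).im = r3
  ring

lemma integ_of (F : E3 → ℝ) (hF : Continuous F) (hc : HasCompactSupport F) : Integrable F :=
  hF.integrable_of_hasCompactSupport hc

lemma int_div (x₀ : E3) (M : E3 →L[ℝ] E3) (G : E3 → ℝ) (hG : ContDiff ℝ 1 G)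
    (hc : HasCompactSupport G) :
    Integrable (fun x => fderiv ℝ G x (M (x - x₀))) ∧
    ∫ x, fderiv ℝ G x (M (x - x₀)) =
      - ((∑ j, (M (EuclideanSpace.single j 1)) j) * ∫ x, G x) := by
  have hGd : Differentiable ℝ G := hG.differentiable (by norm_num)
  have hGc : Continuous (fderiv ℝ G) := hG.continuous_fderiv (by norm_num)
  have key : ∀ j : Fin 3, Integrable (fun x => (M (x - x₀)) j * fderiv ℝ G x (EuclideanSpace.single j 1)) ∧
      ∫ x, (M (x - x₀)) j * fderiv ℝ G x (EuclideanSpace.single j 1)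
       = - ((M (EuclideanSpace.single j 1)) j * ∫ x, G x) := by
    intro j
    set P : E3 →L[ℝ] ℝ := (EuclideanSpace.proj j : E3 →L[ℝ] ℝ).comp M with hP
    have hf : ∀ x, HasFDerivAt (fun x : E3 => (M (x - x₀)) j) P x := by
      intro x
      have := (P.hasFDerivAt (x := x - x₀)).comp x ((hasFDerivAt_id x).sub_const x₀)
      rw [ContinuousLinearMap.comp_id] at this
      exact this
    have hfc : Continuous (fun x : E3 => (M (x - x₀)) j) :=
      continuous_iff_continuousAt.2 fun x => (hf x).continuousAt
    have e1 : ∀ x, fderiv ℝ (fun x : E3 => (M (x - x₀)) j) x (EuclideanSpace.single j 1)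
       = (M (EuclideanSpace.single j 1)) j := by
      intro x; rw [(hf x).fderiv]; rfl
    have i2 : Integrable (fun x => (M (x - x₀)) j * fderiv ℝ G x (EuclideanSpace.single j 1)) := by
      apply integ_of
      · exact hfc.mul (hGc.clm_apply continuous_const)
      · exact (hc.fderiv_apply (𝕜 := ℝ) _).mul_left
    refine ⟨i2, ?_⟩
    rw [integral_mul_fderiv_eq_neg_fderiv_mul_of_integrable]
    · simp only [e1, integral_const_mul]
    · simp only [e1]
      exact (integ_of G hG.continuous hc).const_mul _
    · exact i2
    · exact integ_of _ (hfc.mul hG.continuous) hc.mul_left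
    · exact fun x _ => (hf x).differentiableAt
    · exact fun x _ => hGd x
  have e : ∀ x, fderiv ℝ G x (M (x - x₀)) =
     ∑ j, (M (x - x₀)) j * fderiv ℝ G x (EuclideanSpace.single j 1) := by
    intro x
    conv_lhs => rw [E3_decomp (M (x - x₀))]
    simp [Fin.sum_univ_three]
  simp only [e]
  refine ⟨integrable_finsetSum _ fun j _ => (key j).1, ?_⟩
  rw [integral_finsetSum _ fun j _ => (key j).1, Finset.sum_mul, ← Finset.sum_neg_distrib]
  exact Finset.sum_congr rfl fun j _ => (key j).2

lemma int_E (x₀ : E3) (G : E3 → ℝ) (hG : ContDiff ℝ 1 G) (hc : HasCompactSupport G) :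
    Integrable (fun x => fderiv ℝ G x (x - x₀) + 3 * G x) ∧
    ∫ x, (fderiv ℝ G x (x - x₀) + 3 * G x) = 0 := by
  obtain ⟨h1, h2⟩ := int_div x₀ (ContinuousLinearMap.id ℝ E3) G hG hc
  simp only [ContinuousLinearMap.id_apply] at h1 h2
  have i := (integ_of G hG.continuous hc).const_mul 3
  refine ⟨h1.add i, ?_⟩
  rw [integral_add h1 i, h2, integral_const_mul]
  simp

lemma int_R (x₀ : E3) (l : Fin 3) (G : E3 → ℝ) (hG : ContDiff ℝ 1 G) (hc : HasCompactSupport G) :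
    Integrable (fun x => fderiv ℝ G x (rotM l (x - x₀))) ∧
    ∫ x, (fderiv ℝ G x (rotM l (x - x₀))) = 0 := by
  obtain ⟨h1, h2⟩ := int_div x₀ (rotM l) G hG hc
  refine ⟨h1, ?_⟩
  rw [h2]
  fin_cases l <;> simp [Fin.sum_univ_three, rotM_apply]

lemma fderiv_ip (f g : E3 → Fin 2 → ℂ) (x z : E3) (hf : DifferentiableAt ℝ f x)
    (hg : DifferentiableAt ℝ g x) :
    fderiv ℝ (fun y => ipV (f y) (g y)) x z = ipV (fderiv ℝ f x z) (g x) + ipV (f x) (fderiv ℝ g x z) := by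
  rw [ContinuousLinearMap.fderiv_of_bilinear _ hf hg]
  simp [add_comm]

lemma fderiv_field (x₀ : E3) (v : E3 → Fin 2 → ℂ) (hv : ContDiff ℝ 2 v) (M : E3 →L[ℝ] E3) (x z : E3) :
    fderiv ℝ (fun y => fderiv ℝ v y (M (y - x₀))) x z
     = fderiv ℝ (fderiv ℝ v) x z (M (x - x₀)) + fderiv ℝ v x (M z) := by
  have h1 : DifferentiableAt ℝ (fderiv ℝ v) x :=
    (hv.fderiv_right (m := 1) (by norm_num)).differentiable (by norm_num) x
  have h2 : HasFDerivAt (fun y : E3 => M (y - x₀)) M x := by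
    have := (M.hasFDerivAt (x := x - x₀)).comp x ((hasFDerivAt_id x).sub_const x₀)
    rw [ContinuousLinearMap.comp_id] at this
    exact this
  rw [(h1.hasFDerivAt.clm_apply h2).fderiv]
  simp [add_comm]

lemma contDiff_field (x₀ : E3) (v : E3 → Fin 2 → ℂ) (hv : ContDiff ℝ 2 v) (M : E3 →L[ℝ] E3) :
    ContDiff ℝ 1 (fun y => fderiv ℝ v y (M (y - x₀))) := by
  have h1 : ContDiff ℝ 1 (fderiv ℝ v) := hv.fderiv_right (m := 1) (by norm_num)
  exact h1.clm_apply (M.contDiff.comp (contDiff_id.sub contDiff_const))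

lemma core (x₀ : E3) (v : E3 → Fin 2 → ℂ) (hv : ContDiff ℝ 2 v) (hc : HasCompactSupport v)
    (g : E3 → ℝ) (L : ℝ) (hgv : ContDiff ℝ 1 (fun x => g x • v x))
    (hE : ∀ x, fderiv ℝ (fun x => g x • v x) x (x - x₀) = L • v x + g x • fderiv ℝ v x (x - x₀))
    (W : E3 → Fin 2 → ℂ)
    (hW : W = fun x => fderiv ℝ v x (x - x₀) + (3/2 : ℝ) • v x -
      (g x • v x + ∑ l, JV l (fderiv ℝ v x (rotM l (x - x₀))))) :
    Integrable (fun x => ipV (v x) (v x)) ∧ Integrable (fun x => ipV (W x) (W x)) ∧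
    L * ∫ x, ipV (v x) (v x) ≤ ∫ x, ipV (W x) (W x) := by
  have hv1 : ContDiff ℝ 1 v := hv.of_le (by norm_num)
  have hvd : Differentiable ℝ v := hv.differentiable (by norm_num)
  have hE1 : ContDiff ℝ 1 (fun y => fderiv ℝ v y (y - x₀)) :=
    contDiff_field x₀ v hv (ContinuousLinearMap.id ℝ E3)
  have hR1 : ∀ l, ContDiff ℝ 1 (fun y => fderiv ℝ v y (rotM l (y - x₀))) :=
    fun l => contDiff_field x₀ v hv (rotM l)
  have hip : ∀ f g : E3 → Fin 2 → ℂ, ContDiff ℝ 1 f → ContDiff ℝ 1 g →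
      ContDiff ℝ 1 (fun x => ipV (f x) (g x)) := fun f g hf hg =>
    (ipV.contDiff.comp hf).clm_apply hg
  have hcs : ∀ f : E3 → Fin 2 → ℂ, HasCompactSupport (fun x => ipV (f x) (v x)) := by
    intro f
    refine hc.mono ?_
    intro x hx hx0
    apply hx
    simp [show v x = 0 from hx0]
  have hcs' : ∀ f : E3 → Fin 2 → ℂ, HasCompactSupport (fun x => ipV (v x) (f x)) := by
    intro f
    simpa only [ipV_comm] using hcs f
  have hWc : ContDiff ℝ 1 W := by
    rw [hW]
    refine (hE1.add (hv1.const_smul _)).sub (hgv.add (ContDiff.sum fun l _ => ?_))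
    exact (JV l).contDiff.comp (hR1 l)
  have hWs : HasCompactSupport (fun x => ipV (W x) (W x)) := by
    refine HasCompactSupport.intro' hc (isClosed_tsupport v) ?_
    intro x hx
    have h1 : v x = 0 := image_eq_zero_of_notMem_tsupport hx
    have h2 : fderiv ℝ v x = 0 := fderiv_of_notMem_tsupport ℝ hx
    simp [hW, h1, h2]
  have iv := integ_of _ (hip v v hv1 hv1).continuous (hcs v)
  have iW := integ_of _ (hip W W hWc hWc).continuous hWs
  refine ⟨iv, iW, ?_⟩
  have j0 := int_E x₀ _ (hip _ v hgv hv1) (hcs _)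
  have jJ : ∀ l, ContDiff ℝ 1 (fun x => JV l (fderiv ℝ v x (rotM l (x - x₀)))) :=
    fun l => (JV l).contDiff.comp (hR1 l)
  have jE : ∀ l, ContDiff ℝ 1 (fun x => JV l (fderiv ℝ v x (x - x₀))) :=
    fun l => (JV l).contDiff.comp hE1
  have j1 := fun l => int_E x₀ _ (hip v _ hv1 (jJ l)) (hcs' _)
  have j2 := fun l => int_R x₀ l _ (hip v _ hv1 (jE l)) (hcs' _)
  have tot : ∫ x, (L * ipV (v x) (v x)
      - (fderiv ℝ (fun x => ipV (g x • v x) (v x)) x (x - x₀) + 3 * ipV (g x • v x) (v x))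
      - ∑ l, (fderiv ℝ (fun x => ipV (v x) (JV l (fderiv ℝ v x (rotM l (x - x₀))))) x (x - x₀)
          + 3 * ipV (v x) (JV l (fderiv ℝ v x (rotM l (x - x₀)))))
      + ∑ l, fderiv ℝ (fun x => ipV (v x) (JV l (fderiv ℝ v x (x - x₀)))) x (rotM l (x - x₀)))
      = L * ∫ x, ipV (v x) (v x) := by
    rw [integral_add, integral_sub, integral_sub, integral_const_mul, j0.2,
      integral_finsetSum _ fun l _ => (j1 l).1, integral_finsetSum _ fun l _ => (j2 l).1]
    · rw [Finset.sum_eq_zero fun l _ => (j1 l).2, Finset.sum_eq_zero fun l _ => (j2 l).2]; ring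
    · exact iv.const_mul _
    · exact j0.1
    · exact (iv.const_mul _).sub j0.1
    · exact integrable_finsetSum _ fun l _ => (j1 l).1
    · exact ((iv.const_mul _).sub j0.1).sub (integrable_finsetSum _ fun l _ => (j1 l).1)
    · exact integrable_finsetSum _ fun l _ => (j2 l).1
  rw [← tot]
  refine integral_mono ?_ iW ?_
  · exact (((iv.const_mul _).sub j0.1).sub (integrable_finsetSum _ fun l _ => (j1 l).1)).add
      (integrable_finsetSum _ fun l _ => (j2 l).1)
  intro x
  have hsymm : IsSymmSndFDerivAt ℝ v x := hv.contDiffAt.isSymmSndFDerivAt (by simp)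
  have hJf : ∀ (l : Fin 3) (f : E3 → Fin 2 → ℂ) (z : E3), DifferentiableAt ℝ f x →
      fderiv ℝ (fun x => JV l (f x)) x z = JV l (fderiv ℝ f x z) := by
    intro l f z hf
    have := ((JV l).hasFDerivAt (x := f x)).comp x hf.hasFDerivAt
    have h2 : fderiv ℝ (fun x => JV l (f x)) x = _ := this.fderiv
    rw [h2]; rfl
  have d1 : ∀ {f : E3 → Fin 2 → ℂ}, ContDiff ℝ 1 f → DifferentiableAt ℝ f x :=
    fun hf => hf.differentiable (by norm_num) x
  have k0 := fderiv_ip (fun x => g x • v x) v x (x - x₀) (d1 hgv) (hvd x)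
  have k1 := fun l => fderiv_ip v _ x (x - x₀) (hvd x) (d1 (jJ l))
  have k2 := fun l => fderiv_ip v _ x (rotM l (x - x₀)) (hvd x) (d1 (jE l))
  have fe : ∀ z, fderiv ℝ (fun y => fderiv ℝ v y (y - x₀)) x z
     = fderiv ℝ (fderiv ℝ v) x z (x - x₀) + fderiv ℝ v x z :=
    fun z => fderiv_field x₀ v hv (ContinuousLinearMap.id ℝ E3) x z
  simp only [k0, k1, k2, hJf _ _ _ (d1 hE1), hJf _ _ _ (d1 (hR1 _)), fderiv_field x₀ v hv, fe, hE]
  rw [hW]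
  simp only [hsymm (x - x₀) _]
  generalize hdv : fderiv ℝ v x (x - x₀) = e
  generalize v x = a
  have sk := fun l => ipV_skew l (fderiv ℝ v x (rotM l (x - x₀))) e
  simp only [sk]
  have e1 : ∀ p q : Fin 2 → ℂ, ipV (p - q) (p - q) = ipV p p + ipV q q - 2 * ipV p q := by
    intro p q
    simp only [map_sub, _root_.sub_apply, ipV_comm q p]; ring
  rw [e1]
  have n1 := ipV_nonneg (e + (3/2 : ℝ) • a)
  have n2 := ipV_nonneg (g x • a + ∑ l, JV l (fderiv ℝ v x (rotM l (x - x₀))))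
  have : ipV (e + (3/2 : ℝ) • a) (g x • a + ∑ l, JV l (fderiv ℝ v x (rotM l (x - x₀)))) =
     g x * ipV e a + 3/2 * g x * ipV a a + ∑ l, ipV e (JV l (fderiv ℝ v x (rotM l (x - x₀))))
      + 3/2 * ∑ l, ipV a (JV l (fderiv ℝ v x (rotM l (x - x₀)))) := by
    simp only [map_add, map_smul, map_sum, _root_.add_apply, _root_.smul_apply,
      smul_eq_mul, Fin.sum_univ_three]
    ring
  rw [this]
  have c := ipV_comm a e
  simp only [map_add, map_smul, _root_.add_apply, _root_.smul_apply,
      smul_eq_mul, Fin.sum_univ_three] at n1 n2 ⊢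
  rw [c]
  linarith

lemma cd_smul (n : WithTop ℕ∞) (f : E3 → ℝ) (u : E3 → Fin 2 → ℂ) (hu : ContDiff ℝ n u)
    (hf : ∀ x ∈ tsupport u, ContDiffAt ℝ n f x) : ContDiff ℝ n (fun x => f x • u x) := by
  rw [contDiff_iff_contDiffAt]
  intro x
  by_cases hx : x ∈ tsupport u
  · exact (hf x hx).smul hu.contDiffAt
  · have h := notMem_tsupport_iff_eventuallyEq.1 hx
    refine (contDiffAt_const (c := (0 : Fin 2 → ℂ))).congr_of_eventuallyEq ?_
    filter_upwards [h] with z hz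
    simp [hz]

lemma ts_smul (f : E3 → ℝ) (u : E3 → Fin 2 → ℂ) : tsupport (fun x => f x • u x) ⊆ tsupport u := by
  apply closure_mono
  intro x hx h0
  apply hx
  simp [show u x = 0 from h0]

lemma hasFDerivAt_T (x₀ x : E3) (hx : x ≠ x₀) :
    HasFDerivAt (fun x : E3 => Real.log ‖x - x₀‖) ((‖x - x₀‖^2)⁻¹ • innerSL ℝ (x - x₀)) x := by
  have h0 : ‖x - x₀‖ ≠ 0 := by simpa [sub_eq_zero] using hx
  have h1 : HasFDerivAt (fun x : E3 => ‖x - x₀‖^2) _ x := ((hasFDerivAt_id x).sub_const x₀).norm_sq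
  have h2 := (h1.log (by positivity)).const_mul (1/2)
  have e : (fun x : E3 => Real.log ‖x - x₀‖) = fun x : E3 => 1/2 * Real.log (‖x - x₀‖^2) := by
    funext z; rw [Real.log_pow]; push_cast; ring
  rw [e]
  refine h2.congr_fderiv ?_
  refine ContinuousLinearMap.ext fun z => ?_
  change (1/2 : ℝ) * ((‖x - x₀‖^2)⁻¹ * ((2 : ℕ) • (inner ℝ (x - x₀) z : ℝ))) =
    (‖x - x₀‖^2)⁻¹ * (inner ℝ (x - x₀) z : ℝ)
  rw [nsmul_eq_mul]; push_cast; ring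

lemma contDiffAt_T (n : WithTop ℕ∞) (x₀ x : E3) (hx : x ≠ x₀) :
    ContDiffAt ℝ n (fun x : E3 => Real.log ‖x - x₀‖) x := by
  have h0 : x - x₀ ≠ 0 := sub_ne_zero.2 hx
  exact ((contDiffAt_id.sub contDiffAt_const).norm ℝ h0).log (norm_ne_zero_iff.2 h0)

lemma rot_inner (l : Fin 3) (y : E3) : inner ℝ y (rotM l y) = (0 : ℝ) := by
  fin_cases l <;> simp [PiLp.inner_apply, Fin.sum_univ_three, rotM_apply] <;> ring

def wT (x₀ : E3) (s L : ℝ) (x : E3) : ℝ :=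
  (s - 3/2) * Real.log ‖x - x₀‖ + L * (Real.log ‖x - x₀‖)^2 / 2

lemma free_est (x₀ : E3) (s L : ℝ) (u : E3 → Fin 2 → ℂ) (hu : ContDiff ℝ 2 u)
    (hc : HasCompactSupport u) (hx₀ : x₀ ∉ tsupport u) :
    Integrable (fun x => Real.exp (2 * wT x₀ s L x) * ∑ k, ‖u x k‖^2) ∧
    Integrable (fun x => Real.exp (2 * wT x₀ s L x) * (‖x - x₀‖^2 * ∑ k, ‖sigmaD u x k‖^2)) ∧
    L * ∫ x, Real.exp (2 * wT x₀ s L x) * ∑ k, ‖u x k‖^2 ≤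
      ∫ x, Real.exp (2 * wT x₀ s L x) * (‖x - x₀‖^2 * ∑ k, ‖sigmaD u x k‖^2) := by
  have hne : ∀ x ∈ tsupport u, x ≠ x₀ := fun x hx h => hx₀ (h ▸ hx)
  set T : E3 → ℝ := fun x => Real.log ‖x - x₀‖ with hT
  have hTd : ∀ x ∈ tsupport u, HasFDerivAt T ((‖x - x₀‖^2)⁻¹ • innerSL ℝ (x - x₀)) x :=
    fun x hx => hasFDerivAt_T x₀ x (hne x hx)
  have hTy : ∀ x ∈ tsupport u, fderiv ℝ T x (x - x₀) = 1 := by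
    intro x hx
    have h0 : ‖x - x₀‖ ≠ 0 := by simpa [sub_eq_zero] using hne x hx
    rw [(hTd x hx).fderiv]
    rw [_root_.smul_apply, innerSL_apply_apply, real_inner_self_eq_norm_sq, smul_eq_mul]
    field_simp
  have hTr : ∀ l, ∀ x ∈ tsupport u, fderiv ℝ T x (rotM l (x - x₀)) = 0 := by
    intro l x hx
    rw [(hTd x hx).fderiv]
    rw [_root_.smul_apply, innerSL_apply_apply, rot_inner, smul_zero]
  have hTc : ∀ n : WithTop ℕ∞, ∀ x ∈ tsupport u, ContDiffAt ℝ n T x :=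
    fun n x hx => contDiffAt_T n x₀ x (hne x hx)
  set w : E3 → ℝ := wT x₀ s L with hw
  have hwT : w = fun x => (s - 3/2) * T x + L * (T x)^2 / 2 := rfl
  have hwc : ∀ n : WithTop ℕ∞, ∀ x ∈ tsupport u, ContDiffAt ℝ n w x := by
    intro n x hx
    rw [hwT]
    exact (contDiffAt_const.mul (hTc n x hx)).add
      ((contDiffAt_const.mul ((hTc n x hx).pow 2)).div_const 2)
  have hwd : ∀ x ∈ tsupport u, ∀ z, fderiv ℝ w x z = (s - 3/2 + L * T x) * fderiv ℝ T x z := by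
    intro x hx z
    have h := (hTd x hx).differentiableAt.hasFDerivAt
    have h2 : HasFDerivAt (fun x => (s - 3/2) * T x + L / 2 * (T x * T x)) _ x :=
      (h.const_mul (s - 3/2)).add ((h.mul h).const_mul (L/2))
    have e : w = (fun x => (s - 3/2) * T x + L / 2 * (T x * T x)) := by
      rw [hwT]; funext x; ring
    rw [e, h2.fderiv]
    simp
    ring
  set v : E3 → Fin 2 → ℂ := fun x => Real.exp (w x) • u x with hv
  have hvC : ContDiff ℝ 2 v := cd_smul 2 _ u hu fun x hx => (hwc 2 x hx).exp
  have hvs : tsupport v ⊆ tsupport u := ts_smul _ u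
  have hvc : HasCompactSupport v := hc.of_isClosed_subset (isClosed_tsupport v) hvs
  have hvd : ∀ x ∈ tsupport u, ∀ z, fderiv ℝ v x z =
      Real.exp (w x) • (fderiv ℝ u x z + fderiv ℝ w x z • u x) := by
    intro x hx z
    have h1 : HasFDerivAt w (fderiv ℝ w x) x := ((hwc 1 x hx).differentiableAt (by norm_num)).hasFDerivAt
    have h2 : HasFDerivAt u (fderiv ℝ u x) x := (hu.differentiable (by norm_num) x).hasFDerivAt
    have h3 : fderiv ℝ v x = _ := (h1.exp.smul h2).fderiv
    rw [h3]
    simp [smul_smul, smul_add]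
  set g : E3 → ℝ := fun x => s + L * T x with hg
  have hgc : ∀ n : WithTop ℕ∞, ∀ x ∈ tsupport u, ContDiffAt ℝ n g x :=
    fun n x hx => contDiffAt_const.add (contDiffAt_const.mul (hTc n x hx))
  have hgv : ContDiff ℝ 1 (fun x => g x • v x) :=
    cd_smul 1 g v (hvC.of_le (by norm_num)) fun x hx => hgc 1 x (hvs hx)
  have hE : ∀ x, fderiv ℝ (fun x => g x • v x) x (x - x₀) = L • v x + g x • fderiv ℝ v x (x - x₀) := by
    intro x
    by_cases hx : x ∈ tsupport u
    · have h1 : HasFDerivAt g (L • fderiv ℝ T x) x :=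
        ((hTd x hx).differentiableAt.hasFDerivAt.const_mul L).const_add s
      have h2 : HasFDerivAt v (fderiv ℝ v x) x := (hvC.differentiable (by norm_num) x).hasFDerivAt
      have h3 : fderiv ℝ (fun x => g x • v x) x = _ := (h1.smul h2).fderiv
      rw [h3]
      simp [-map_sub, hTy x hx, add_comm]
    · have h1 : x ∉ tsupport v := fun h => hx (hvs h)
      have h2 : x ∉ tsupport (fun x => g x • v x) := fun h => h1 (ts_smul g v h)
      rw [fderiv_of_notMem_tsupport ℝ h1, fderiv_of_notMem_tsupport ℝ h2,
        image_eq_zero_of_notMem_tsupport h1]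
      simp
  obtain ⟨i1, i2, i3⟩ := core x₀ v hvC hvc g L hgv hE _ rfl
  have ipsm : ∀ (c : ℝ) (a : Fin 2 → ℂ), ipV (Real.exp c • a) (Real.exp c • a) =
      Real.exp (2 * c) * ipV a a := by
    intro c a
    rw [two_mul, Real.exp_add]
    simp only [map_smul, _root_.smul_apply, smul_eq_mul]; ring
  have E1 : (fun x => ipV (v x) (v x)) = fun x => Real.exp (2 * w x) * ∑ k, ‖u x k‖^2 := by
    funext x
    rw [hv, ipsm, ipV_self]
  have E2 : (fun x => ipV (fderiv ℝ v x (x - x₀) + (3/2 : ℝ) • v x -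
      (g x • v x + ∑ l, JV l (fderiv ℝ v x (rotM l (x - x₀)))))
      (fderiv ℝ v x (x - x₀) + (3/2 : ℝ) • v x -
      (g x • v x + ∑ l, JV l (fderiv ℝ v x (rotM l (x - x₀)))))) =
      fun x => Real.exp (2 * w x) * (‖x - x₀‖^2 * ∑ k, ‖sigmaD u x k‖^2) := by
    funext x
    by_cases hx : x ∈ tsupport u
    · have : fderiv ℝ v x (x - x₀) + (3/2 : ℝ) • v x -
        (g x • v x + ∑ l, JV l (fderiv ℝ v x (rotM l (x - x₀)))) =
        Real.exp (w x) • (fderiv ℝ u x (x - x₀) - ∑ l, JV l (fderiv ℝ u x (rotM l (x - x₀)))) := by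
        simp only [hvd x hx, hwd x hx, hTr _ x hx, hTy x hx, mul_zero, zero_smul, add_zero, map_smul,
          ← Finset.smul_sum]
        rw [hv, hg]
        module
      rw [this, ipsm, alg_sigma, EuclideanSpace.norm_sq_eq, Fin.sum_univ_three]
      simp only [Real.norm_eq_abs, sq_abs]
      rfl
    · have h1 : x ∉ tsupport v := fun h => hx (hvs h)
      have h3 : fderiv ℝ u x = 0 := fderiv_of_notMem_tsupport ℝ hx
      rw [fderiv_of_notMem_tsupport ℝ h1, image_eq_zero_of_notMem_tsupport h1]
      simp [sigmaD, pdV, h3]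
  rw [E1] at i1
  rw [E2] at i2
  refine ⟨i1, i2, ?_⟩
  have E1' := congrArg (fun f : E3 → ℝ => ∫ x, f x) E1
  have E2' := congrArg (fun f : E3 → ℝ => ∫ x, f x) E2
  beta_reduce at E1' E2' i3
  rw [E1', E2'] at i3
  exact i3

lemma integ_mul (K : Set E3) (hK : IsCompact K) (c n : E3 → ℝ) (hn : Continuous n)
    (h0 : ∀ x, x ∉ K → n x = 0) (hcc : ∀ x ∈ K, ContinuousAt c x) :
    Integrable (fun x => c x * n x) := by
  have h1 : IntegrableOn (fun x => c x * n x) K :=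
    ContinuousOn.integrableOn_compact hK
      fun x hx => ((hcc x hx).mul hn.continuousAt).continuousWithinAt
  refine (integrableOn_iff_integrable_of_support_subset ?_).1 h1
  intro x hx
  by_contra h
  exact hx (by simp [h0 x h])

lemma bound_B (m : ℝ) (a : Fin 3 → ℝ) (q : ℝ) (ha : ∀ j, |a j| ≤ m) (hq : |q| ≤ m)
    (p u : Fin 2 → ℂ) :
    ∑ k, ‖p k‖^2 ≤ 2 * ∑ k, ‖(p + (pauli fun j => (a j : ℂ)).mulVec u + (q : ℂ) • u) k‖^2
      + 32 * m^2 * ∑ k, ‖u k‖^2 := by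
  have hm : 0 ≤ m := (abs_nonneg _).trans hq
  set B : Fin 2 → ℂ := (pauli fun j => (a j : ℂ)).mulVec u + (q : ℂ) • u with hB
  have hs : ∀ k, ‖p k‖^2 ≤ 2 * ‖(p + B) k‖^2 + 2 * ‖B k‖^2 := by
    intro k
    have h1 : ‖p k‖ ≤ ‖(p + B) k‖ + ‖B k‖ := by
      have := norm_sub_le ((p + B) k) (B k)
      simpa using this
    nlinarith [norm_nonneg (p k), sq_nonneg (‖(p + B) k‖ - ‖B k‖)]
  have e0 : B 0 = ((a 2 : ℂ) + q) * u 0 + ((a 0 : ℂ) - Complex.I * a 1) * u 1 := by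
    simp [hB, pauli, σ1, σ2, σ3, dotProduct, Fin.sum_univ_two, Matrix.vecHead, Matrix.vecTail]; ring
  have e1 : B 1 = ((a 0 : ℂ) + Complex.I * a 1) * u 0 + (-(a 2 : ℂ) + q) * u 1 := by
    simp [hB, pauli, σ1, σ2, σ3, dotProduct, Fin.sum_univ_two, Matrix.vecHead, Matrix.vecTail]; ring
  have na : ∀ j, ‖(a j : ℂ)‖ ≤ m := fun j => by simpa using ha j
  have nq : ‖(q : ℂ)‖ ≤ m := by simpa using hq
  have nI : ∀ j, ‖Complex.I * (a j : ℂ)‖ ≤ m := fun j => by simpa using ha j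
  have c1 : ‖(a 2 : ℂ) + q‖ ≤ 2 * m := by linarith [norm_add_le (a 2 : ℂ) q, na 2]
  have c2 : ‖(a 0 : ℂ) - Complex.I * a 1‖ ≤ 2 * m := by
    linarith [norm_sub_le (a 0 : ℂ) (Complex.I * a 1), na 0, nI 1]
  have c3 : ‖(a 0 : ℂ) + Complex.I * a 1‖ ≤ 2 * m := by
    linarith [norm_add_le (a 0 : ℂ) (Complex.I * a 1), na 0, nI 1]
  have c4 : ‖-(a 2 : ℂ) + q‖ ≤ 2 * m := by
    have := norm_add_le (-(a 2 : ℂ)) q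
    rw [norm_neg] at this
    linarith [na 2]
  have gen : ∀ c d : ℂ, ‖c‖ ≤ 2 * m → ‖d‖ ≤ 2 * m →
      ‖c * u 0 + d * u 1‖^2 ≤ 8 * m^2 * (‖u 0‖^2 + ‖u 1‖^2) := by
    intro c d hc hd
    have h1 : ‖c * u 0 + d * u 1‖ ≤ 2 * m * (‖u 0‖ + ‖u 1‖) := by
      have := norm_add_le (c * u 0) (d * u 1)
      rw [norm_mul, norm_mul] at this
      nlinarith [mul_le_mul_of_nonneg_right hc (norm_nonneg (u 0)),
        mul_le_mul_of_nonneg_right hd (norm_nonneg (u 1))]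
    have h2 := pow_le_pow_left₀ (norm_nonneg _) h1 2
    nlinarith [mul_nonneg (sq_nonneg m) (sq_nonneg (‖u 0‖ - ‖u 1‖))]
  have b0 := gen _ _ c1 c2
  have b1 := gen _ _ c3 c4
  rw [← e0] at b0
  rw [← e1] at b1
  have s0 := hs 0
  have s1 := hs 1
  rw [add_assoc, ← hB]
  simp only [Fin.sum_univ_two]
  linarith

/-- Carleman estimate for the Dirac operator with convexified logarithmic
weight (interior version): `∫ e^{2φ̃/h}|u|² ≤ C ε(h) ∫ e^{2φ̃/h}|σ·(D+A)u + qu|²` for all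
`u ∈ C_c^∞(Ω; ℂ²)`. -/
theorem dirac_carleman_estimate
    (Ω : Set E3) (hΩo : IsOpen Ω) (hΩb : Bornology.IsBounded Ω)
    (x₀ : E3) (hx₀ : x₀ ∉ closure Ω)
    (A : E3 → Fin 3 → ℝ) (q : E3 → ℝ)
    (hA : ContDiff ℝ (⊤ : ℕ∞) A) (hAb : ∀ n : ℕ, ∃ M : ℝ, ∀ x, ‖iteratedFDeriv ℝ n A x‖ ≤ M)
    (hq : ContDiff ℝ (⊤ : ℕ∞) q) (hqb : ∀ n : ℕ, ∃ M : ℝ, ∀ x, ‖iteratedFDeriv ℝ n q x‖ ≤ M) :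
    ∃ C₀ C : ℝ, 1 ≤ C₀ ∧ 0 < C ∧
      ∀ α ∈ Set.Ioo (0 : ℝ) 1, ∃ h₀ ∈ Set.Ioo (0 : ℝ) 1, ∀ h ∈ Set.Ioc (0 : ℝ) h₀,
        ∀ u : E3 → Fin 2 → ℂ,
          ContDiff ℝ (⊤ : ℕ∞) u → HasCompactSupport u → tsupport u ⊆ Ω →
          (∫ x in Ω, Real.exp (2 * carlPhiT x₀ C₀ α h x / h) * ∑ k, ‖u x k‖ ^ 2)
            ≤ C * carlEps C₀ α h *
              ∫ x in Ω, Real.exp (2 * carlPhiT x₀ C₀ α h x / h) *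
                ∑ k, ‖(sigmaDA A u x + (q x : ℂ) • u x) k‖ ^ 2 := by
  obtain ⟨MA, hMA⟩ := hAb 0
  obtain ⟨Mq, hMq⟩ := hqb 0
  simp only [norm_iteratedFDeriv_zero] at hMA hMq
  set m : ℝ := max MA Mq with hm
  have hAm : ∀ x j, |A x j| ≤ m := fun x j =>
    ((norm_le_pi_norm (A x) j).trans (hMA x)).trans (le_max_left _ _)
  have hqm : ∀ x, |q x| ≤ m := fun x => (hMq x).trans (le_max_right _ _)
  obtain ⟨r0, hr0, hr0'⟩ : ∃ r0 > 0, ∀ x ∈ Ω, r0 ≤ ‖x - x₀‖ := by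
    obtain ⟨r, hr, hb⟩ := Metric.isOpen_iff.1 isClosed_closure.isOpen_compl x₀ hx₀
    refine ⟨r, hr, fun x hx => ?_⟩
    by_contra hlt
    push Not at hlt
    exact hb (by rwa [Metric.mem_ball, dist_eq_norm]) (subset_closure hx)
  obtain ⟨r1, hr1, hr1'⟩ : ∃ r1 > 0, ∀ x ∈ Ω, ‖x - x₀‖ ≤ r1 := by
    obtain ⟨r, hr⟩ := hΩb.subset_closedBall x₀
    refine ⟨max r 1, by positivity, fun x hx => ?_⟩
    have := hr hx
    rw [Metric.mem_closedBall, dist_eq_norm] at this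
    exact this.trans (le_max_left _ _)
  set K : ℝ := r1^3 * r0⁻¹ with hK
  have hKpos : 0 < K := by positivity
  refine ⟨1, 4 * K, le_rfl, by positivity, ?_⟩
  rintro α ⟨hα, hα1⟩
  set Q : ℝ := 64 * m^2 * K + 1 with hQ
  have hQpos : 0 < Q := by positivity
  refine ⟨Real.exp (-(Q / α)), ⟨Real.exp_pos _, by rw [Real.exp_lt_one_iff]; simp; positivity⟩, ?_⟩
  rintro h ⟨hh, hh1⟩ u hu hc hs
  set L : ℝ := α * |Real.log h| with hL
  have hLQ : Q ≤ L := by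
    have h1 : Real.log h ≤ -(Q / α) := by
      rw [← Real.log_exp (-(Q/α))]; exact Real.log_le_log hh hh1
    have h2 : Q / α ≤ |Real.log h| := by
      have := neg_le_abs (Real.log h); linarith
    rw [div_le_iff₀ hα] at h2
    rw [hL]; linarith
  have hLpos : 0 < L := hQpos.trans_le hLQ
  have heps : carlEps 1 α h = L⁻¹ := by rw [carlEps, one_mul]
  set ew : E3 → ℝ := fun x => Real.exp (2 * carlPhiT x₀ 1 α h x / h) with hew
  set Nu : E3 → ℝ := fun x => ∑ k, ‖u x k‖^2 with hNu
  set NP : E3 → ℝ := fun x => ∑ k, ‖(sigmaDA A u x + (q x : ℂ) • u x) k‖ ^ 2 with hNP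
  have hne : ∀ x ∈ Ω, 0 < ‖x - x₀‖ := fun x hx => hr0.trans_le (hr0' x hx)
  have hx0u : x₀ ∉ tsupport u := fun hx => hx₀ (subset_closure (hs hx))
  have hu1 : ContDiff ℝ 2 u := hu.of_le (WithTop.coe_le_coe.2 (le_top (a := (2 : ℕ∞))))
  obtain ⟨f1, f2, f3⟩ := free_est x₀ (1/h) L u hu1 hc hx0u
  have hew' : ∀ x ∈ Ω, ew x = Real.exp (2 * wT x₀ (1/h) L x) * ‖x - x₀‖^3 := by
    intro x hx
    have e3 : ‖x - x₀‖^3 = Real.exp (3 * Real.log ‖x - x₀‖) := by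
      rw [mul_comm, Real.exp_mul, Real.exp_log (hne x hx)]; norm_cast
    rw [e3, ← Real.exp_add, hew]
    beta_reduce
    congr 1
    rw [carlPhiT, wT, heps]
    field_simp
    ring
  have hew0 : ∀ x, 0 < ew x := fun x => Real.exp_pos _
  have hNu0 : ∀ x, x ∉ tsupport u → Nu x = 0 := by
    intro x hx
    simp [hNu, image_eq_zero_of_notMem_tsupport hx]
  have hsD0 : ∀ x, x ∉ tsupport u → sigmaD u x = 0 := by
    intro x hx
    simp [sigmaD, pdV, fderiv_of_notMem_tsupport ℝ hx]
  have hNP0 : ∀ x, x ∉ tsupport u → NP x = 0 := by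
    intro x hx
    simp [hNP, sigmaDA, hsD0 x hx, image_eq_zero_of_notMem_tsupport hx]
  have hNuc : Continuous Nu := by
    have := hu.continuous
    rw [hNu]; fun_prop
  have hpc : ∀ j, Continuous (pdV j u) := fun j =>
    (hu1.continuous_fderiv (by norm_num)).clm_apply continuous_const
  have hNPc : Continuous NP := by
    have h1 := hu.continuous
    have h2 := hA.continuous
    have h3 := hq.continuous
    have h4 : Continuous (sigmaD u) := by
      unfold sigmaD
      have k1 : Continuous fun x => σ1.mulVec (pdV 0 u x) := continuous_const.matrix_mulVec (hpc 0)
      have k2 : Continuous fun x => σ2.mulVec (pdV 1 u x) := continuous_const.matrix_mulVec (hpc 1)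
      have k3 : Continuous fun x => σ3.mulVec (pdV 2 u x) := continuous_const.matrix_mulVec (hpc 2)
      exact ((k1.add k2).add k3).const_smul (-Complex.I)
    have h5 : Continuous (fun x => pauli fun j => (A x j : ℂ)) := by
      unfold pauli
      fun_prop
    have h6 : Continuous (fun x => sigmaDA A u x + (q x : ℂ) • u x) := by
      unfold sigmaDA
      exact (h4.add (h5.matrix_mulVec h1)).add ((Complex.continuous_ofReal.comp h3).smul h1)
    rw [hNP]
    exact continuous_finsetSum _ fun k _ => (((continuous_apply k).comp h6).norm).pow 2
  have hewc : ∀ x ∈ tsupport u, ContinuousAt ew x := by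
    intro x hx
    have hT := (contDiffAt_T 0 x₀ x (fun hxx => hx0u (hxx ▸ hx))).continuousAt
    have : ContinuousAt (carlPhiT x₀ 1 α h) x := by
      unfold carlPhiT
      exact hT.add ((continuousAt_const.mul (hT.pow 2)).div_const 2)
    exact ((continuousAt_const.mul this).div_const h).rexp
  have iI : Integrable (fun x => ew x * Nu x) := integ_mul _ hc ew Nu hNuc hNu0 hewc
  have iJ : Integrable (fun x => ew x * NP x) := integ_mul _ hc ew NP hNPc hNP0 hewc
  have eI : ∫ x in Ω, ew x * Nu x = ∫ x, ew x * Nu x :=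
    setIntegral_eq_integral_of_forall_compl_eq_zero fun x hx => by
      rw [hNu0 x fun h => hx (hs h), mul_zero]
  have eJ : ∫ x in Ω, ew x * NP x = ∫ x, ew x * NP x :=
    setIntegral_eq_integral_of_forall_compl_eq_zero fun x hx => by
      rw [hNP0 x fun h => hx (hs h), mul_zero]
  change ∫ x in Ω, ew x * Nu x ≤ 4 * K * carlEps 1 α h * ∫ x in Ω, ew x * NP x
  rw [eI, eJ, heps]
  have hNun : ∀ x, 0 ≤ Nu x := fun x => Finset.sum_nonneg fun k _ => by positivity
  have I0 : 0 ≤ ∫ x, ew x * Nu x := integral_nonneg fun x => mul_nonneg (hew0 x).le (hNun x)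
  have s1 : ∫ x, ew x * Nu x ≤ r1^3 * ∫ x, Real.exp (2 * wT x₀ (1/h) L x) * Nu x := by
    rw [← integral_const_mul]
    refine integral_mono iI (f1.const_mul _) fun x => ?_
    beta_reduce
    by_cases hx : x ∈ tsupport u
    · rw [hew' x (hs hx)]
      have : ‖x - x₀‖^3 ≤ r1^3 := pow_le_pow_left₀ (norm_nonneg _) (hr1' x (hs hx)) 3
      have h2 : 0 ≤ Real.exp (2 * wT x₀ (1/h) L x) * Nu x := mul_nonneg (Real.exp_pos _).le (hNun x)
      have := mul_le_mul_of_nonneg_right this h2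
      calc _ = ‖x - x₀‖^3 * (Real.exp (2 * wT x₀ (1/h) L x) * Nu x) := by ring
        _ ≤ _ := this
    · have := hNu0 x hx
      rw [this]; simp [image_eq_zero_of_notMem_tsupport hx]
  have s2 : ∫ x, Real.exp (2 * wT x₀ (1/h) L x) * (‖x - x₀‖^2 * ∑ k, ‖sigmaD u x k‖^2) ≤
      r0⁻¹ * (2 * (∫ x, ew x * NP x) + 32 * m^2 * ∫ x, ew x * Nu x) := by
    rw [← integral_const_mul, ← integral_const_mul, ← integral_add (iJ.const_mul _) (iI.const_mul _),
      ← integral_const_mul]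
    refine integral_mono f2 (((iJ.const_mul _).add (iI.const_mul _)).const_mul _) fun x => ?_
    beta_reduce
    by_cases hx : x ∈ tsupport u
    · have hb := bound_B m (A x) (q x) (hAm x) (hqm x) (sigmaD u x) (u x)
      change ∑ k, ‖sigmaD u x k‖^2 ≤ 2 * NP x + 32 * m^2 * Nu x at hb
      have hS : 0 ≤ ∑ k, ‖sigmaD u x k‖^2 := Finset.sum_nonneg fun k _ => by positivity
      have hr : 1 ≤ r0⁻¹ * ‖x - x₀‖ := by
        rw [inv_mul_eq_div, one_le_div hr0]; exact hr0' x (hs hx)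
      rw [show r0⁻¹ * (2 * (ew x * NP x) + 32 * m^2 * (ew x * Nu x)) =
        r0⁻¹ * (ew x * (2 * NP x + 32 * m^2 * Nu x)) by ring]
      calc _ = Real.exp (2 * wT x₀ (1/h) L x) * (‖x - x₀‖^2 * ∑ k, ‖sigmaD u x k‖^2) * 1 := by ring
        _ ≤ Real.exp (2 * wT x₀ (1/h) L x) * (‖x - x₀‖^2 * ∑ k, ‖sigmaD u x k‖^2) * (r0⁻¹ * ‖x - x₀‖) := by
            gcongr
        _ = r0⁻¹ * (ew x * ∑ k, ‖sigmaD u x k‖^2) := by rw [hew' x (hs hx)]; ring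
        _ ≤ _ := by
            have := (hew0 x).le
            gcongr
    · rw [hsD0 x hx, hNP0 x hx, hNu0 x hx]; simp
  set I := ∫ x, ew x * Nu x with hI
  set J := ∫ x, ew x * NP x with hJ
  have s3 : L * I ≤ K * (2 * J + 32 * m^2 * I) := by
    calc L * I ≤ L * (r1^3 * ∫ x, Real.exp (2 * wT x₀ (1/h) L x) * Nu x) := by gcongr
      _ = r1^3 * (L * ∫ x, Real.exp (2 * wT x₀ (1/h) L x) * Nu x) := by ring
      _ ≤ r1^3 * (r0⁻¹ * (2 * J + 32 * m^2 * I)) := by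
        have := f3.trans s2
        gcongr
      _ = _ := by rw [hK]; ring
  have s4 : L * I ≤ 4 * K * J := by
    have : (64 * m^2 * K) * I ≤ L * I := by
      apply mul_le_mul_of_nonneg_right _ I0
      linarith
    linarith
  rw [show 4 * K * L⁻¹ * J = (4 * K * J) / L by rw [div_eq_mul_inv]; ring, le_div_iff₀ hLpos]
  linarith
end
end

section
/- Carleman estimate for a second-order operator with h-dependent singular lower-order coefficients (interior version of Lemma 5.1 of the paper for compactly supported functions): Let Ω ⊆ ℝ³ be a bounded open set, x₀ ∈ ℝ³ ∖ closure(Ω), and let A : ℝ³ → ℝ³, q₋ : ℝ³ → ℝ, q̃ : ℝ³ → ℂ be smooth with all derivatives bounded. For h, α ∈ (0,1) let S_h = { x ∈ Ω : |q₋(x)| · √(α|log h|) ≥ 1 }, and for v ∈ C_c^∞(Ω; ℂ²) define Lv(x) = −Δv(x) − 2i A(x)·∇v(x) + q̃(x) v(x) − 𝟙_{S_h}(x) (1/q₋(x)) (σ·Dq₋(x)) (σ·(D+A)v)(x). Then there exist constants C₀ ≥ 1 and C > 0 such that for every α ∈ (0,1) there is h₀ ∈ (0,1) so that for all h ∈ (0,h₀],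 setting ε(h) = (C₀ α |log h|)⁻¹ and φ̃ = φ + (h/ε(h)) φ²/2 with φ(x) = log|x−x₀|, every v ∈ C_c^∞(Ω; ℂ²) satisfies (h²/ε(h)) ( ∫_Ω e^{2φ̃/h} |v|² dx + ∫_Ω e^{2φ̃/h} |h∇v|² dx ) ≤ C ∫_Ω e^{2φ̃/h} h⁴ |Lv|² dx. -/
noncomputable section

open MeasureTheory

/-- Partial derivative `∂ⱼ` of a real-valued function. -/
def pdR (j : Fin 3) (f : E3 → ℝ) (x : E3) : ℝ := fderiv ℝ f x (EuclideanSpace.single j 1)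

/-- Laplacian of a `ℂ²`-valued function, componentwise. -/
def lapV (f : E3 → Fin 2 → ℂ) (x : E3) : Fin 2 → ℂ := ∑ j, pdV j (pdV j f) x

/-- The set `S_h = {x ∈ Ω : |q₋(x)| √(α|log h|) ≥ 1}` where one can decouple. -/
def Sset (Ω : Set E3) (qm : E3 → ℝ) (α h : ℝ) : Set E3 :=
  {x ∈ Ω | 1 ≤ |qm x| * Real.sqrt (α * |Real.log h|)}

/-- The second-order operator
`Lv = −Δv − 2iA·∇v + q̃v − 𝟙_{S_h} (1/q₋)(σ·Dq₋)(σ·(D+A)v)`. -/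
def Lop (Ω : Set E3) (A : E3 → Fin 3 → ℝ) (qm : E3 → ℝ) (qt : E3 → ℂ) (α h : ℝ)
    (v : E3 → Fin 2 → ℂ) (x : E3) : Fin 2 → ℂ :=
  -lapV v x - (2 * Complex.I) • (∑ j, ((A x j : ℂ)) • pdV j v x) + qt x • v x
    - Set.indicator (Sset Ω qm α h)
        (fun y => ((qm y : ℂ))⁻¹ •
          (pauli fun j => -Complex.I * ((pdR j qm y : ℝ) : ℂ)).mulVec (sigmaDA A v y)) x

def HP (j : Fin 3) (f : E3 → ℝ) (f' : ℝ) (x : E3) : Prop :=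
  HasDerivAt (fun t : ℝ => f (x + t • EuclideanSpace.single j (1 : ℝ))) f' 0

lemma HP.mul {j f g f' g' x} (hf : HP j f f' x) (hg : HP j g g' x) :
    HP j (fun x => f x * g x) (f' * g x + f x * g') x := by
  have := HasDerivAt.mul (𝕜 := ℝ) hf hg
  simpa [HP, Pi.mul_def] using this

lemma HP.add {j f g f' g' x} (hf : HP j f f' x) (hg : HP j g g' x) :
    HP j (fun x => f x + g x) (f' + g') x := by
  have := HasDerivAt.add (𝕜 := ℝ) hf hg
  simpa [HP, Pi.add_def] using this

lemma HP.const (j : Fin 3) (c : ℝ) (x : E3) : HP j (fun _ => c) 0 x := by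
  simpa [HP] using hasDerivAt_const (0 : ℝ) c

lemma HP.comp {j f f' x} {g : ℝ → ℝ} {g' : ℝ} (hg : HasDerivAt g g' (f x)) (hf : HP j f f' x) :
    HP j (fun x => g (f x)) (g' * f') x := by
  unfold HP at *
  have h0 : (fun t : ℝ => f (x + t • EuclideanSpace.single j (1 : ℝ))) 0 = f x := by simp
  exact HasDerivAt.comp (h₂ := g) (0 : ℝ) (by simpa using hg) hf

lemma HP.congr {j f f' g' x} (hf : HP j f f' x) (h : f' = g') : HP j f g' x := h ▸ hf

lemma hp_of_diff {j : Fin 3} {f : E3 → ℝ} {x : E3} (hf : DifferentiableAt ℝ f x) :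
    HP j f (pdR j f x) x := by
  have := hf.hasFDerivAt.hasLineDerivAt (EuclideanSpace.single j (1 : ℝ))
  exact this

lemma HP.unique {j f f' g' x} (hf : HP j f f' x) (hg : HP j f g' x) : f' = g' :=
  HasDerivAt.unique (𝕜 := ℝ) hf hg

lemma HP.congr_ev {j f g f' x} (hf : HP j f f' x) (h : g =ᶠ[nhds x] f) : HP j g f' x := by
  unfold HP at *
  refine hf.congr_of_eventuallyEq ?_
  have hc : Filter.Tendsto (fun t : ℝ => x + t • EuclideanSpace.single j (1 : ℝ)) (nhds 0)
      (nhds x) := by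
    have : Continuous (fun t : ℝ => x + t • EuclideanSpace.single j (1 : ℝ)) := by fun_prop
    simpa using this.tendsto 0
  exact hc.eventually h

def del (k j : Fin 3) : ℝ := if k = j then 1 else 0

lemma hp_coord (x₀ : E3) (j k : Fin 3) (x : E3) : HP j (fun x => x k - x₀ k) (del k j) x := by
  unfold HP del
  have h1 : HasDerivAt (fun t : ℝ => t * (if k = j then (1 : ℝ) else 0))
      (1 * (if k = j then (1 : ℝ) else 0)) 0 := (hasDerivAt_id (0 : ℝ)).mul_const _
  have := h1.const_add (x k - x₀ k)
  have e : (fun t : ℝ => (fun x : E3 => x k - x₀ k) (x + t • EuclideanSpace.single j (1 : ℝ)))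
      = fun t : ℝ => (x k - x₀ k) + t * (if k = j then (1 : ℝ) else 0) := by
    ext t
    simp [PiLp.single_apply]
    ring
  rw [e]
  simpa using this

def rho (x₀ x : E3) : ℝ :=
  (x 0 - x₀ 0) * (x 0 - x₀ 0) + (x 1 - x₀ 1) * (x 1 - x₀ 1) + (x 2 - x₀ 2) * (x 2 - x₀ 2)
def ph (x₀ x : E3) : ℝ := Real.log (rho x₀ x) * (1 / 2)
def FF (x₀ : E3) (τ : ℝ) (x : E3) : ℝ := 1 + τ * ph x₀ x
def psi (x₀ : E3) (τ h : ℝ) (x : E3) : ℝ := h⁻¹ * (ph x₀ x + τ * (1 / 2) * (ph x₀ x * ph x₀ x))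
def mm (x₀ : E3) (τ h : ℝ) (x : E3) : ℝ := h⁻¹ * (FF x₀ τ x * (rho x₀ x)⁻¹)
def mu (x₀ : E3) (τ h : ℝ) (x : E3) : ℝ :=
  h⁻¹ * ((τ - 2 * FF x₀ τ x) * ((rho x₀ x)⁻¹ * (rho x₀ x)⁻¹))
def aa (x₀ : E3) (τ h : ℝ) (x : E3) : ℝ := h⁻¹ * ((τ + (-1) * FF x₀ τ x) * (rho x₀ x)⁻¹)
def be (x₀ : E3) (τ h : ℝ) (x : E3) : ℝ :=
  h⁻¹ * ((2 * FF x₀ τ x - 3 * τ) * ((rho x₀ x)⁻¹ * (rho x₀ x)⁻¹))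

lemma hp_rho (x₀ : E3) (j : Fin 3) (x : E3) : HP j (rho x₀) (2 * (x j - x₀ j)) x := by
  have h := fun k => hp_coord x₀ j k x
  refine ((((h 0).mul (h 0)).add ((h 1).mul (h 1))).add ((h 2).mul (h 2))).congr ?_
  fin_cases j <;> simp [del] <;> ring

lemma hp_ph (x₀ : E3) (j : Fin 3) (x : E3) (hr : 0 < rho x₀ x) :
    HP j (ph x₀) ((rho x₀ x)⁻¹ * (x j - x₀ j)) x := by
  refine ((HP.comp (Real.hasDerivAt_log hr.ne') (hp_rho x₀ j x)).mul (HP.const j (1/2) x)).congr ?_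
  ring

lemma hp_inv (x₀ : E3) (j : Fin 3) (x : E3) (hr : 0 < rho x₀ x) :
    HP j (fun x => (rho x₀ x)⁻¹) (-2 * ((rho x₀ x)⁻¹ * (rho x₀ x)⁻¹) * (x j - x₀ j)) x := by
  refine ((HP.comp (hasDerivAt_inv hr.ne') (hp_rho x₀ j x))).congr ?_
  field_simp

lemma hp_FF (x₀ : E3) (τ : ℝ) (j : Fin 3) (x : E3) (hr : 0 < rho x₀ x) :
    HP j (FF x₀ τ) (τ * ((rho x₀ x)⁻¹ * (x j - x₀ j))) x := by
  refine ((HP.const j 1 x).add ((HP.const j τ x).mul (hp_ph x₀ j x hr))).congr ?_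
  ring

lemma hp_psi (x₀ : E3) (τ h : ℝ) (j : Fin 3) (x : E3) (hr : 0 < rho x₀ x) :
    HP j (psi x₀ τ h) (mm x₀ τ h x * (x j - x₀ j)) x := by
  have p := hp_ph x₀ j x hr
  refine ((HP.const j h⁻¹ x).mul (p.add ((HP.const j (τ * (1/2)) x).mul (p.mul p)))).congr ?_
  simp only [mm, FF]; ring

lemma hp_mm (x₀ : E3) (τ h : ℝ) (j : Fin 3) (x : E3) (hr : 0 < rho x₀ x) :
    HP j (mm x₀ τ h) (mu x₀ τ h x * (x j - x₀ j)) x := by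
  refine ((HP.const j h⁻¹ x).mul ((hp_FF x₀ τ j x hr).mul (hp_inv x₀ j x hr))).congr ?_
  simp only [mu]; ring

lemma hp_aa (x₀ : E3) (τ h : ℝ) (j : Fin 3) (x : E3) (hr : 0 < rho x₀ x) :
    HP j (aa x₀ τ h) (be x₀ τ h x * (x j - x₀ j)) x := by
  refine ((HP.const j h⁻¹ x).mul (((HP.const j τ x).add ((HP.const j (-1) x).mul
    (hp_FF x₀ τ j x hr))).mul (hp_inv x₀ j x hr))).congr ?_
  simp only [be]; ring

lemma aa_eq (x₀ : E3) (τ h : ℝ) (x : E3) (hr : 0 < rho x₀ x) :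
    aa x₀ τ h x = mm x₀ τ h x + mu x₀ τ h x * rho x₀ x := by
  simp only [aa, mm, mu]; field_simp; ring

def XX (x₀ : E3) (w : E3 → ℝ) (x : E3) : ℝ :=
  (x 0 - x₀ 0) * pdR 0 w x + (x 1 - x₀ 1) * pdR 1 w x + (x 2 - x₀ 2) * pdR 2 w x
def G2 (w : E3 → ℝ) (x : E3) : ℝ :=
  pdR 0 w x * pdR 0 w x + pdR 1 w x * pdR 1 w x + pdR 2 w x * pdR 2 w x
def lap (w : E3 → ℝ) (x : E3) : ℝ :=
  pdR 0 (pdR 0 w) x + pdR 1 (pdR 1 w) x + pdR 2 (pdR 2 w) x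

def VV (x₀ : E3) (τ h : ℝ) (w : E3 → ℝ) (j : Fin 3) (x : E3) : ℝ :=
  (-4) * (mm x₀ τ h x * (XX x₀ w x * pdR j w x)) + 2 * (mm x₀ τ h x * ((x j - x₀ j) * G2 w x))
   + ((-2) * (aa x₀ τ h x * (w x * pdR j w x))
   + (-2) * (rho x₀ x * ((mm x₀ τ h x * (mm x₀ τ h x * mm x₀ τ h x)) *
      ((x j - x₀ j) * (w x * w x)))))

lemma pdR_symm {w : E3 → ℝ} (hw : ContDiff ℝ (⊤ : ℕ∞) w) (i j : Fin 3) (x : E3) :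
    pdR i (pdR j w) x = pdR j (pdR i w) x := by
  have h2 : IsSymmSndFDerivAt ℝ w x := by
    apply ContDiffAt.isSymmSndFDerivAt (n := (⊤ : ℕ∞)) hw.contDiffAt
    simp
    exact WithTop.coe_le_coe.2 le_top
  have hd : DifferentiableAt ℝ (fderiv ℝ w) x :=
    (hw.fderiv_right (m := (⊤ : ℕ∞)) (by simp)).differentiable (by simp) x
  have key : ∀ i j, pdR i (pdR j w) x = fderiv ℝ (fderiv ℝ w) x (EuclideanSpace.single i 1)
      (EuclideanSpace.single j 1) := by
    intro i j
    unfold pdR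
    rw [fderiv_clm_apply hd (by fun_prop)]
    simp
  rw [key, key]
  exact h2.eq _ _

lemma pdR_contDiff {w : E3 → ℝ} (hw : ContDiff ℝ (⊤ : ℕ∞) w) (j : Fin 3) :
    ContDiff ℝ (⊤ : ℕ∞) (pdR j w) := by
  unfold pdR
  exact (hw.fderiv_right (m := (⊤ : ℕ∞)) (by simp)).clm_apply contDiff_const

lemma cd_diff {w : E3 → ℝ} (hw : ContDiff ℝ (⊤ : ℕ∞) w) (x : E3) : DifferentiableAt ℝ w x :=
  hw.differentiable (by simp) x

lemma hp_VV (x₀ : E3) (τ h : ℝ) {w : E3 → ℝ} (hw : ContDiff ℝ (⊤ : ℕ∞) w) (x : E3)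
    (hr : 0 < rho x₀ x) :
    ∃ d : Fin 3 → ℝ, (∀ j, HP j (VV x₀ τ h w j) (d j) x) ∧
      d 0 + d 1 + d 2 = 2 * (lap w x + rho x₀ x * mm x₀ τ h x ^ 2 * w x) *
        (-2 * mm x₀ τ h x * XX x₀ w x - aa x₀ τ h x * w x)
        - 4 * mu x₀ τ h x * XX x₀ w x ^ 2 - 2 * be x₀ τ h x * w x * XX x₀ w x
        - 4 * rho x₀ x * mm x₀ τ h x ^ 2 * (2 * mm x₀ τ h x + rho x₀ x * mu x₀ τ h x)
          * w x ^ 2 := by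
  have y := fun j k => hp_coord x₀ j k x
  have hm := fun j => hp_mm x₀ τ h j x hr
  have ha := fun j => hp_aa x₀ τ h j x hr
  have hrho := fun j => hp_rho x₀ j x
  have w0 := fun j => hp_of_diff (j := j) (cd_diff hw x)
  have w1 := fun j k => hp_of_diff (j := j) (cd_diff (pdR_contDiff hw k) x)
  have hX : ∀ j, HP j (XX x₀ w) _ x := fun j =>
    (((y j 0).mul (w1 j 0)).add ((y j 1).mul (w1 j 1))).add ((y j 2).mul (w1 j 2))
  have hG : ∀ j, HP j (G2 w) _ x := fun j =>
    (((w1 j 0).mul (w1 j 0)).add ((w1 j 1).mul (w1 j 1))).add ((w1 j 2).mul (w1 j 2))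
  have hV : ∀ j, HP j (VV x₀ τ h w j) _ x := fun j =>
    (((HP.const j (-4) x).mul ((hm j).mul ((hX j).mul (w1 j j)))).add
      ((HP.const j 2 x).mul ((hm j).mul ((y j j).mul (hG j))))).add
     (((HP.const j (-2) x).mul ((ha j).mul ((w0 j).mul (w1 j j)))).add
      ((HP.const j (-2) x).mul ((hrho j).mul (((hm j).mul ((hm j).mul (hm j))).mul
        ((y j j).mul ((w0 j).mul (w0 j)))))))
  refine ⟨_, hV, ?_⟩
  rw [aa_eq x₀ τ h x hr]
  rw [pdR_symm hw 1 0, pdR_symm hw 2 0, pdR_symm hw 2 1]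
  simp only [del, XX, G2, lap]
  simp
  generalize mm x₀ τ h x = m
  generalize mu x₀ τ h x = μ
  generalize be x₀ τ h x = b
  simp only [rho]
  ring


lemma alg_ineq (h ε τ F ρ R w X L G P m μ a b dV : ℝ) (hh : 0 < h) (hh1 : h ≤ 1/1000)
    (hε : 0 < ε) (hε1 : ε ≤ 1/9) (hτ : τ = h / ε) (hτ1 : τ ≤ 1) (hF1 : 1/2 ≤ F) (hF2 : F ≤ 2)
    (hρ : 0 < ρ) (hρR : ρ ≤ R) (hR : 4 * R^2 * h * τ ≤ 1)
    (hm : m = h⁻¹ * (F * ρ⁻¹)) (hμ : μ = h⁻¹ * ((τ - 2 * F) * (ρ⁻¹ * ρ⁻¹)))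
    (ha : a = h⁻¹ * ((τ + (-1) * F) * ρ⁻¹)) (hb : b = h⁻¹ * ((2 * F - 3 * τ) * (ρ⁻¹ * ρ⁻¹)))
    (hP : P = L - 2 * m * X + (ρ * m^2 - 3 * m - μ * ρ) * w)
    (hdV : dV = 2 * (L + ρ * m ^ 2 * w) * (-2 * m * X - a * w)
        - 4 * μ * X ^ 2 - 2 * b * w * X - 4 * ρ * m ^ 2 * (2 * m + ρ * μ) * w ^ 2) :
    ε⁻¹ * ((h⁻¹)^2 * w^2 + (2 * G + 2 * ρ * m^2 * w^2)) ≤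
      2 * (1 + 4 * R + 4 * R^2) * P^2 + 2 * ε⁻¹ * (G + w * L) - (1 + 4 * R + 4 * R^2) * dV := by
  have hτ0 : 0 < τ := by rw [hτ]; positivity
  have hhi : 0 < h⁻¹ := by positivity
  have hρi : 0 < ρ⁻¹ := by positivity
  have hm0 : 0 < m := by rw [hm]; positivity
  have haeq : a = m + μ * ρ := by rw [ha, hm, hμ]; field_simp; ring
  have h2m : 2 * m + ρ * μ = h⁻¹ * τ * ρ⁻¹ := by rw [hm, hμ]; field_simp; ring
  have hmain : 4 * ρ * m ^ 2 * (2 * m + ρ * μ) = 4 * ε⁻¹ * m^2 := by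
    rw [h2m, hτ]; field_simp
  obtain ⟨S, hS⟩ : ∃ S, S = L + ρ * m^2 * w := ⟨_, rfl⟩
  obtain ⟨T, hT⟩ : ∃ T, T = -2 * m * X - a * w := ⟨_, rfl⟩
  have hPST : S + T = P + 2 * m * w := by rw [hP, hS, hT, haeq]; ring
  have hST : (S + T)^2 ≤ 2 * P^2 + 8 * m^2 * w^2 := by
    rw [hPST]; linarith [sq_nonneg (P - 2 * m * w), show (P + 2 * m * w)^2 + (P - 2 * m * w)^2 = 2 * P^2 + 8 * m^2 * w^2 by ring]
  have hQ0 : 0 < h⁻¹ * (ρ⁻¹ * ρ⁻¹) := by positivity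
  have hQ : h⁻¹ * (ρ⁻¹ * ρ⁻¹) ≤ 4 * (h * m^2) := by
    have : h * m^2 = F^2 * (h⁻¹ * (ρ⁻¹ * ρ⁻¹)) := by rw [hm]; field_simp
    have hF : 1/4 ≤ F^2 := by
      have : (1/2 : ℝ)^2 ≤ F^2 := by gcongr
      linarith
    have := mul_le_mul_of_nonneg_right hF hQ0.le
    linarith
  have hμb : |μ| ≤ 16 * (h * m^2) := by
    have : μ = (τ - 2 * F) * (h⁻¹ * (ρ⁻¹ * ρ⁻¹)) := by rw [hμ]; ring
    rw [this, abs_mul, abs_of_pos hQ0]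
    have h1 : |τ - 2 * F| ≤ 4 := abs_le.2 ⟨by linarith, by linarith⟩
    have := mul_le_mul_of_nonneg_right h1 hQ0.le
    linarith
  have hbb : |b| ≤ 28 * (h * m^2) := by
    have : b = (2 * F - 3 * τ) * (h⁻¹ * (ρ⁻¹ * ρ⁻¹)) := by rw [hb]; ring
    rw [this, abs_mul, abs_of_pos hQ0]
    have h1 : |2 * F - 3 * τ| ≤ 7 := abs_le.2 ⟨by linarith, by linarith⟩
    have := mul_le_mul_of_nonneg_right h1 hQ0.le
    linarith
  have hab : a^2 ≤ 16 * m^2 := by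
    have hq : 0 < h⁻¹ * ρ⁻¹ := by positivity
    have e1 : a = (τ - F) * (h⁻¹ * ρ⁻¹) := by rw [ha]; ring
    have e2 : m = F * (h⁻¹ * ρ⁻¹) := by rw [hm]; ring
    rw [e1, e2]
    generalize h⁻¹ * ρ⁻¹ = q at *
    rw [mul_pow, mul_pow, ← mul_assoc]
    apply mul_le_mul_of_nonneg_right _ (by positivity)
    have : (τ - F)^2 ≤ 2^2 := sq_le_sq' (by linarith) (by linarith)
    have : (1/2 : ℝ)^2 ≤ F^2 := by gcongr
    linarith
  obtain ⟨Y, hY⟩ : ∃ Y, Y = T + a * w := ⟨_, rfl⟩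
  have hYX : Y = -2 * m * X := by rw [hY, hT]; ring
  have hY2 : Y^2 ≤ 2 * T^2 + 32 * (m^2 * w^2) := by
    have : (a*w)^2 ≤ 16 * (m^2 * w^2) := by
      rw [mul_pow]; linarith [mul_le_mul_of_nonneg_right hab (sq_nonneg w)]
    rw [hY]; linarith [sq_nonneg (T - a * w), show (T + a * w)^2 + (T - a * w)^2 = 2 * T^2 + 2 * (a * w)^2 by ring]
  have t1 : -4 * μ * X^2 ≤ 16 * h * Y^2 := by
    have : -μ ≤ 16 * (h * m^2) := (neg_le_abs μ).trans hμb
    have h2 : -μ * X^2 ≤ 16 * (h * m^2) * X^2 := mul_le_mul_of_nonneg_right this (sq_nonneg X)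
    have e : 16 * h * Y^2 = 4 * (16 * (h * m^2) * X^2) := by rw [hYX]; ring
    linarith
  have t2 : -2 * b * w * X ≤ 14 * h * (m^2 * w^2 + Y^2) := by
    have h1 : -2 * b * w * X ≤ 2 * (|b| * |w * X|) := by
      have := neg_le_abs (b * (w * X)); rw [abs_mul] at this; linarith
    have h2 : |b| * |w * X| ≤ 28 * (h * m^2) * |w * X| :=
      mul_le_mul_of_nonneg_right hbb (abs_nonneg _)
    have h3 : 2 * (2 * m^2 * |w * X|) ≤ m^2 * w^2 + Y^2 := by
      rw [hYX, abs_mul]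
      have e1 := sq_abs w
      have e2 := sq_abs X
      have := sq_nonneg (m * |w| - 2 * m * |X|)
      have e3 : (m * |w| - 2 * m * |X|)^2 = m^2 * w^2 + 4 * m^2 * X^2 - 4 * m^2 * (|w| * |X|) := by
        rw [← e1, ← e2]; ring
      linarith [show (-2 * m * X)^2 = 4 * m^2 * X^2 by ring]
    have h4 := mul_le_mul_of_nonneg_left h3 (show 0 ≤ 14 * h by positivity)
    linarith
  have hmw : 0 ≤ m^2 * w^2 := by positivity
  have t3 : -4 * μ * X^2 + -2 * b * w * X ≤ T^2 + m^2 * w^2 := by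
    have h1 : 30 * h * Y^2 ≤ 30 * h * (2 * T^2 + 32 * (m^2 * w^2)) :=
      mul_le_mul_of_nonneg_left hY2 (by positivity)
    have h2 : h * T^2 ≤ 1/1000 * T^2 := mul_le_mul_of_nonneg_right hh1 (sq_nonneg T)
    have h3 : h * (m^2 * w^2) ≤ 1/1000 * (m^2 * w^2) := mul_le_mul_of_nonneg_right hh1 hmw
    linarith [sq_nonneg T]
  have hεi : 9 ≤ ε⁻¹ := by
    rw [le_inv_comm₀ (by norm_num) hε]; linarith
  have key : S^2 + 3 * ε⁻¹ * (m^2 * w^2) + dV ≤ 2 * P^2 := by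
    have e : dV = 2 * S * T + (-4 * μ * X^2 + -2 * b * w * X) - 4 * ε⁻¹ * m^2 * w^2 := by
      rw [hdV, hmain, ← hS, ← hT]; ring
    have h1 : 9 * (m^2 * w^2) ≤ ε⁻¹ * (m^2 * w^2) := mul_le_mul_of_nonneg_right hεi hmw
    linarith [show (S+T)^2 = S^2 + 2 * S * T + T^2 by ring]
  have hR0 : 0 < R := lt_of_lt_of_le hρ hρR
  have hmR : (h⁻¹)^2 ≤ 4 * R^2 * m^2 := by
    have : 1 ≤ 2 * (R * (F * ρ⁻¹)) := by
      have : 1 ≤ R * ρ⁻¹ := by rw [← div_eq_mul_inv, one_le_div hρ]; exact hρR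
      have h3 : 1 * (1/2) ≤ (R * ρ⁻¹) * F := mul_le_mul this hF1 (by norm_num) (by positivity)
      linarith
    have : h⁻¹ ≤ 2 * R * m := by
      rw [hm]; linarith [mul_le_mul_of_nonneg_left this hhi.le]
    calc (h⁻¹)^2 ≤ (2 * R * m)^2 := by gcongr
      _ = _ := by ring
  have hem : ε⁻¹ ≤ m^2 := by
    have e1 : ε⁻¹ = τ * h⁻¹ := by rw [hτ]; field_simp
    have h1 : 4 * R^2 * ε⁻¹ ≤ (h⁻¹)^2 := by
      rw [e1]
      have : 4 * R^2 * (τ * h⁻¹) = (4 * R^2 * h * τ) * (h⁻¹)^2 := by field_simp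
      rw [this]; linarith [mul_le_mul_of_nonneg_right hR (sq_nonneg h⁻¹)]
    have h2 : 4 * R^2 * ε⁻¹ ≤ 4 * R^2 * m^2 := h1.trans hmR
    exact le_of_mul_le_mul_left h2 (by positivity)
  have f1 : (h⁻¹)^2 * w^2 ≤ 4 * R^2 * (m^2 * w^2) := by
    linarith [mul_le_mul_of_nonneg_right hmR (sq_nonneg w)]
  have f2 : ρ * (m^2 * w^2) ≤ R * (m^2 * w^2) := mul_le_mul_of_nonneg_right hρR hmw
  have f3 : -2 * ε⁻¹ * (w * S) ≤ S^2 + ε⁻¹ * (m^2 * w^2) := by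
    have : ε⁻¹ * w^2 ≤ m^2 * w^2 := mul_le_mul_of_nonneg_right hem (sq_nonneg w)
    have h2 : ε⁻¹ * (ε⁻¹ * w^2) ≤ ε⁻¹ * (m^2 * w^2) :=
      mul_le_mul_of_nonneg_left this (by positivity)
    linarith [sq_nonneg (S + ε⁻¹ * w), show (S + ε⁻¹ * w)^2 = S^2 + 2 * ε⁻¹ * (w * S) + ε⁻¹ * (ε⁻¹ * w^2) by ring]
  have f4 : ε⁻¹ * ((h⁻¹)^2 * w^2 + 4 * (ρ * (m^2 * w^2))) ≤
      ε⁻¹ * (4 * R^2 * (m^2 * w^2) + 4 * (R * (m^2 * w^2))) :=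
    mul_le_mul_of_nonneg_left (by linarith) (by positivity)
  have f5 : (1 + 4 * R + 4 * R^2) * (S^2 + 3 * ε⁻¹ * (m^2 * w^2) + dV) ≤
      (1 + 4 * R + 4 * R^2) * (2 * P^2) := mul_le_mul_of_nonneg_left key (by positivity)
  have hL : L = S - ρ * m^2 * w := by rw [hS]; ring
  have f6 : 0 ≤ (4 * R + 4 * R^2) * S^2 := by positivity
  have f7 : 0 ≤ (1 + 4 * R + 4 * R^2) * (ε⁻¹ * (m^2 * w^2)) := by positivity
  rw [hL]
  linarith


lemma rho_eq (x₀ x : E3) : rho x₀ x = ‖x - x₀‖^2 := by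
  rw [EuclideanSpace.norm_sq_eq, Fin.sum_univ_three]
  simp [rho, sq]

lemma rho_pos {x₀ x : E3} (h : x ≠ x₀) : 0 < rho x₀ x := by
  rw [rho_eq]
  have : 0 < ‖x - x₀‖ := norm_pos_iff.2 (sub_ne_zero.2 h)
  positivity

lemma ph_eq (x₀ x : E3) : ph x₀ x = Real.log ‖x - x₀‖ := by
  rw [ph, rho_eq, Real.log_pow]; push_cast; ring

lemma rho_cd (x₀ : E3) : ContDiff ℝ (⊤ : ℕ∞) (rho x₀) := by
  unfold rho; fun_prop

lemma ph_cd {x₀ x : E3} (h : 0 < rho x₀ x) : ContDiffAt ℝ (⊤ : ℕ∞) (ph x₀) x := by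
  unfold ph
  exact ((rho_cd x₀).contDiffAt.log h.ne').mul contDiffAt_const

lemma rhoi_cd {x₀ x : E3} (h : 0 < rho x₀ x) :
    ContDiffAt ℝ (⊤ : ℕ∞) (fun x => (rho x₀ x)⁻¹) x :=
  (rho_cd x₀).contDiffAt.inv h.ne'

lemma psi_cd {x₀ x : E3} (τ k : ℝ) (h : 0 < rho x₀ x) :
    ContDiffAt ℝ (⊤ : ℕ∞) (psi x₀ τ k) x := by
  have := ph_cd h
  unfold psi; fun_prop

lemma mm_cd {x₀ x : E3} (τ k : ℝ) (h : 0 < rho x₀ x) :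
    ContDiffAt ℝ (⊤ : ℕ∞) (mm x₀ τ k) x := by
  have := ph_cd h
  have := rhoi_cd h
  unfold mm FF; fun_prop

lemma aa_cd {x₀ x : E3} (τ k : ℝ) (h : 0 < rho x₀ x) :
    ContDiffAt ℝ (⊤ : ℕ∞) (aa x₀ τ k) x := by
  have := ph_cd h
  have := rhoi_cd h
  unfold aa FF; fun_prop

def WW (x₀ : E3) (τ h : ℝ) (u : E3 → ℝ) (x : E3) : ℝ := Real.exp (psi x₀ τ h x) * u x

lemma hp_exp (x₀ : E3) (τ h : ℝ) (j : Fin 3) (x : E3) (hr : 0 < rho x₀ x) :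
    HP j (fun x => Real.exp (psi x₀ τ h x))
      (Real.exp (psi x₀ τ h x) * (mm x₀ τ h x * (x j - x₀ j))) x :=
  HP.comp (Real.hasDerivAt_exp _) (hp_psi x₀ τ h j x hr)

lemma WW_pd (x₀ : E3) (τ h : ℝ) {u : E3 → ℝ} (hu : ContDiff ℝ (⊤ : ℕ∞) u)
    (hw : ContDiff ℝ (⊤ : ℕ∞) (WW x₀ τ h u)) (j : Fin 3) (x : E3) (hr : 0 < rho x₀ x) :
    pdR j (WW x₀ τ h u) x = Real.exp (psi x₀ τ h x) *
      (pdR j u x + mm x₀ τ h x * ((x j - x₀ j) * u x)) := by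
  refine (hp_of_diff (cd_diff hw x)).unique
    (((hp_exp x₀ τ h j x hr).mul (hp_of_diff (cd_diff hu x))).congr ?_)
  ring

lemma WW_pd2 (x₀ : E3) (τ h : ℝ) {u : E3 → ℝ} (hu : ContDiff ℝ (⊤ : ℕ∞) u)
    (hw : ContDiff ℝ (⊤ : ℕ∞) (WW x₀ τ h u)) (j : Fin 3) (x : E3) (hr : 0 < rho x₀ x) :
    pdR j (pdR j (WW x₀ τ h u)) x = Real.exp (psi x₀ τ h x) *
      (pdR j (pdR j u) x + 2 * mm x₀ τ h x * (x j - x₀ j) * pdR j u x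
        + (mm x₀ τ h x ^ 2 * (x j - x₀ j)^2 + mu x₀ τ h x * (x j - x₀ j)^2 + mm x₀ τ h x) * u x) := by
  have ev : pdR j (WW x₀ τ h u) =ᶠ[nhds x] fun x => Real.exp (psi x₀ τ h x) *
      (pdR j u x + mm x₀ τ h x * ((x j - x₀ j) * u x)) := by
    filter_upwards [(rho_cd x₀).continuous.continuousAt.eventually (lt_mem_nhds hr)] with z hz
    exact WW_pd x₀ τ h hu hw j z hz
  have d0 := hp_of_diff (j := j) (cd_diff hu x)
  have d1 := hp_of_diff (j := j) (cd_diff (pdR_contDiff hu j) x)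
  have := (((hp_exp x₀ τ h j x hr).mul (d1.add ((hp_mm x₀ τ h j x hr).mul
    ((hp_coord x₀ j j x).mul d0))))).congr_ev ev
  refine (hp_of_diff (cd_diff (pdR_contDiff hw j) x)).unique (this.congr ?_)
  simp [del]; ring

lemma WW_lap (x₀ : E3) (τ h : ℝ) {u : E3 → ℝ} (hu : ContDiff ℝ (⊤ : ℕ∞) u)
    (hw : ContDiff ℝ (⊤ : ℕ∞) (WW x₀ τ h u)) (x : E3) (hr : 0 < rho x₀ x) :
    Real.exp (psi x₀ τ h x) * lap u x = lap (WW x₀ τ h u) x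
      - 2 * mm x₀ τ h x * XX x₀ (WW x₀ τ h u) x
      + (rho x₀ x * mm x₀ τ h x ^ 2 - 3 * mm x₀ τ h x - mu x₀ τ h x * rho x₀ x)
        * WW x₀ τ h u x := by
  simp only [lap, XX, WW_pd2 x₀ τ h hu hw _ x hr, WW_pd x₀ τ h hu hw _ x hr]
  generalize mm x₀ τ h x = m
  generalize mu x₀ τ h x = μ
  simp only [WW, rho]
  ring

lemma WW_grad (x₀ : E3) (τ h : ℝ) {u : E3 → ℝ} (hu : ContDiff ℝ (⊤ : ℕ∞) u)
    (hw : ContDiff ℝ (⊤ : ℕ∞) (WW x₀ τ h u)) (x : E3) (hr : 0 < rho x₀ x) :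
    Real.exp (2 * psi x₀ τ h x) * G2 u x ≤ 2 * G2 (WW x₀ τ h u) x
      + 2 * rho x₀ x * mm x₀ τ h x ^ 2 * WW x₀ τ h u x ^ 2 := by
  have e : ∀ j, Real.exp (psi x₀ τ h x) * pdR j u x = pdR j (WW x₀ τ h u) x -
      mm x₀ τ h x * (x j - x₀ j) * WW x₀ τ h u x := by
    intro j; rw [WW_pd x₀ τ h hu hw j x hr, WW]; ring
  have e2 : Real.exp (2 * psi x₀ τ h x) = Real.exp (psi x₀ τ h x) ^ 2 := by
    rw [← Real.exp_nat_mul]; norm_num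
  have : Real.exp (2 * psi x₀ τ h x) * G2 u x = (Real.exp (psi x₀ τ h x) * pdR 0 u x)^2
      + (Real.exp (psi x₀ τ h x) * pdR 1 u x)^2 + (Real.exp (psi x₀ τ h x) * pdR 2 u x)^2 := by
    rw [e2, G2]; ring
  rw [this, e, e, e, G2, rho]
  generalize mm x₀ τ h x = m
  generalize WW x₀ τ h u x = w
  nlinarith [sq_nonneg (pdR 0 (WW x₀ τ h u) x + m * (x 0 - x₀ 0) * w),
    sq_nonneg (pdR 1 (WW x₀ τ h u) x + m * (x 1 - x₀ 1) * w),
    sq_nonneg (pdR 2 (WW x₀ τ h u) x + m * (x 2 - x₀ 2) * w)]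

lemma supp_zero {u : E3 → ℝ} {x : E3} (hx : x ∉ tsupport u) : u =ᶠ[nhds x] 0 :=
  notMem_tsupport_iff_eventuallyEq.1 hx

lemma pd_supp {u : E3 → ℝ} (j : Fin 3) : tsupport (pdR j u) ⊆ tsupport u :=
  tsupport_fderiv_apply_subset ℝ _

lemma WW_supp (x₀ : E3) (τ h : ℝ) (u : E3 → ℝ) : tsupport (WW x₀ τ h u) ⊆ tsupport u :=
  tsupport_mul_subset_right

lemma cd_of_tsupport {u : E3 → ℝ} (h : ∀ x ∈ tsupport u, ContDiffAt ℝ (⊤ : ℕ∞) u x) :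
    ContDiff ℝ (⊤ : ℕ∞) u := by
  rw [contDiff_iff_contDiffAt]
  intro x
  by_cases hx : x ∈ tsupport u
  · exact h x hx
  · exact (contDiffAt_const (c := (0 : ℝ))).congr_of_eventuallyEq (supp_zero hx)

lemma WW_cd (x₀ : E3) (τ h : ℝ) {u : E3 → ℝ} (hu : ContDiff ℝ (⊤ : ℕ∞) u)
    (hs : ∀ x ∈ tsupport u, 0 < rho x₀ x) : ContDiff ℝ (⊤ : ℕ∞) (WW x₀ τ h u) := by
  apply cd_of_tsupport
  intro x hx
  have hr := hs x (WW_supp x₀ τ h u hx)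
  exact (psi_cd τ h hr).exp.mul hu.contDiffAt

def GG (x₀ : E3) (τ h ε K : ℝ) (w : E3 → ℝ) (j : Fin 3) (x : E3) : ℝ :=
  2 * ε⁻¹ * (w x * pdR j w x) + (-K) * VV x₀ τ h w j x

lemma GG_cd (x₀ : E3) (τ h ε K : ℝ) {w : E3 → ℝ} (hw : ContDiff ℝ (⊤ : ℕ∞) w)
    (hs : ∀ x ∈ tsupport w, 0 < rho x₀ x) (j : Fin 3) :
    ContDiff ℝ (⊤ : ℕ∞) (GG x₀ τ h ε K w j) ∧ tsupport (GG x₀ τ h ε K w j) ⊆ tsupport w := by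
  have hsub : tsupport (GG x₀ τ h ε K w j) ⊆ tsupport w := by
    apply closure_minimal _ (isClosed_tsupport w)
    intro x hx
    by_contra hn
    apply hx
    have h0 : w x = 0 := image_eq_zero_of_notMem_tsupport hn
    have h1 : ∀ k, pdR k w x = 0 := fun k =>
      image_eq_zero_of_notMem_tsupport (fun hh => hn (pd_supp k hh))
    simp [GG, VV, G2, h0, h1]
  refine ⟨?_, hsub⟩
  apply cd_of_tsupport
  intro x hx
  have hr := hs x (hsub hx)
  have a1 := mm_cd τ h hr
  have a2 := aa_cd τ h hr
  have a3 := (rho_cd x₀).contDiffAt (x := x)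
  have a4 := hw.contDiffAt (x := x)
  have a5 := fun k => (pdR_contDiff hw k).contDiffAt (x := x)
  have b0 := a5 0
  have b1 := a5 1
  have b2 := a5 2
  have bj := a5 j
  unfold GG VV XX G2
  fun_prop

lemma pointwise (x₀ : E3) (h ε τ R : ℝ) (hh : 0 < h) (hh1 : h ≤ 1/1000)
    (hε : 0 < ε) (hε1 : ε ≤ 1/9) (hτ : τ = h / ε) (hτ1 : τ ≤ 1) (hR : 4 * R^2 * h * τ ≤ 1)
    {u : E3 → ℝ} (hu : ContDiff ℝ (⊤ : ℕ∞) u) (hs : ∀ x ∈ tsupport u, 0 < rho x₀ x)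
    (x : E3) (hρ : 0 < rho x₀ x) (hρR : rho x₀ x ≤ R)
    (hF1 : 1/2 ≤ FF x₀ τ x) (hF2 : FF x₀ τ x ≤ 2) :
    ε⁻¹ * ((h⁻¹)^2 * (Real.exp (2 * psi x₀ τ h x) * u x ^ 2)
      + Real.exp (2 * psi x₀ τ h x) * G2 u x) ≤
    2 * (1 + 4 * R + 4 * R^2) * (Real.exp (2 * psi x₀ τ h x) * lap u x ^ 2)
      + ∑ j, pdR j (GG x₀ τ h ε (1 + 4 * R + 4 * R^2) (WW x₀ τ h u) j) x := by
  have hw := WW_cd x₀ τ h hu hs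
  set w := WW x₀ τ h u with hwdef
  have hsw : ∀ x ∈ tsupport w, 0 < rho x₀ x := fun x hx => hs x (WW_supp x₀ τ h u hx)
  obtain ⟨d, hd, hdsum⟩ := hp_VV x₀ τ h hw x hρ
  have hpd : ∀ j, pdR j (GG x₀ τ h ε (1 + 4 * R + 4 * R^2) w j) x =
      2 * ε⁻¹ * (pdR j w x * pdR j w x + w x * pdR j (pdR j w) x)
        - (1 + 4 * R + 4 * R^2) * d j := by
    intro j
    refine (hp_of_diff (cd_diff (GG_cd x₀ τ h ε _ hw hsw j).1 x)).unique ?_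
    refine (((HP.const j (2 * ε⁻¹) x).mul ((hp_of_diff (cd_diff hw x)).mul
      (hp_of_diff (cd_diff (pdR_contDiff hw j) x)))).add
      ((HP.const j (-(1 + 4 * R + 4 * R^2)) x).mul (hd j))).congr ?_
    ring
  have e2 : Real.exp (2 * psi x₀ τ h x) = Real.exp (psi x₀ τ h x) ^ 2 := by
    rw [← Real.exp_nat_mul]; norm_num
  have key := alg_ineq h ε τ (FF x₀ τ x) (rho x₀ x) R (w x) (XX x₀ w x) (lap w x) (G2 w x)
    (Real.exp (psi x₀ τ h x) * lap u x) (mm x₀ τ h x) (mu x₀ τ h x) (aa x₀ τ h x) (be x₀ τ h x)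
    (d 0 + d 1 + d 2) hh hh1 hε hε1 hτ hτ1 hF1 hF2 hρ hρR hR rfl rfl rfl rfl
    (WW_lap x₀ τ h hu hw x hρ) hdsum
  have hg := WW_grad x₀ τ h hu hw x hρ
  have hw2 : Real.exp (2 * psi x₀ τ h x) * u x ^ 2 = w x ^ 2 := by
    rw [hwdef, WW, e2]; ring
  have hl2 : Real.exp (2 * psi x₀ τ h x) * lap u x ^ 2 =
    (Real.exp (psi x₀ τ h x) * lap u x)^2 := by rw [e2]; ring
  rw [Fin.sum_univ_three, hpd, hpd, hpd, hw2, hl2]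
  have h1 : ε⁻¹ * ((h⁻¹)^2 * w x ^ 2 + Real.exp (2 * psi x₀ τ h x) * G2 u x) ≤
      ε⁻¹ * ((h⁻¹)^2 * w x^2 + (2 * G2 w x + 2 * rho x₀ x * mm x₀ τ h x^2 * w x^2)) := by
    apply mul_le_mul_of_nonneg_left _ (by positivity)
    linarith
  refine h1.trans (key.trans (le_of_eq ?_))
  simp only [G2, lap]
  ring


def N0 (v : E3 → Fin 2 → ℂ) (x : E3) : ℝ := ∑ k, ‖v x k‖ ^ 2
def N1 (v : E3 → Fin 2 → ℂ) (x : E3) : ℝ := ∑ j, ∑ k, ‖pdV j v x k‖ ^ 2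
def N2 (v : E3 → Fin 2 → ℂ) (x : E3) : ℝ := ∑ k, ‖lapV v x k‖ ^ 2

lemma wint {K : Set E3} (hK : IsCompact K) {c g : E3 → ℝ} (hc : ContinuousOn c K)
    (hg : Continuous g) (h0 : ∀ x, x ∉ K → g x = 0) : Integrable (fun x => c x * g x) := by
  have h1 : IntegrableOn (fun x => c x * g x) K :=
    (hc.mul hg.continuousOn).integrableOn_compact hK
  rw [integrableOn_iff_integrable_of_support_subset] at h1
  · exact h1
  · intro x hx
    by_contra hn
    exact hx (by simp [h0 x hn])

lemma pdR_int {f : E3 → ℝ} (hf : ContDiff ℝ (⊤ : ℕ∞) f) (hc : HasCompactSupport f) (j : Fin 3) :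
    Integrable (pdR j f) ∧ ∫ x, pdR j f x = 0 := by
  have hi : Integrable (pdR j f) :=
    (pdR_contDiff hf j).continuous.integrable_of_hasCompactSupport
      (hc.mono' (subset_closure.trans (pd_supp j)))
  have hi0 : Integrable f := hf.continuous.integrable_of_hasCompactSupport hc
  refine ⟨hi, ?_⟩
  have := integral_mul_fderiv_eq_neg_fderiv_mul_of_integrable (μ := (volume : Measure E3))
    (f := fun _ : E3 => (1 : ℝ)) (g := f) (v := EuclideanSpace.single j (1 : ℝ))
    (by simp) (by simp only [one_mul]; exact hi) (by simpa using hi0) (fun x _ => by fun_prop)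
    (fun x _ => cd_diff hf x)
  simpa [pdR] using this

lemma pdR_clm (L : (Fin 2 → ℂ) →L[ℝ] ℝ) {v : E3 → Fin 2 → ℂ} (hv : Differentiable ℝ v)
    (j : Fin 3) (x : E3) : pdR j (fun x => L (v x)) x = L (pdV j v x) := by
  unfold pdR pdV
  have := (L.hasFDerivAt.comp x (hv x).hasFDerivAt).fderiv
  simp only [Function.comp_def] at this
  rw [this]; rfl

lemma pdV_cd {v : E3 → Fin 2 → ℂ} (hv : ContDiff ℝ (⊤ : ℕ∞) v) (j : Fin 3) :
    ContDiff ℝ (⊤ : ℕ∞) (pdV j v) := by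
  unfold pdV
  exact (hv.fderiv_right (m := (⊤ : ℕ∞)) (by simp)).clm_apply contDiff_const

lemma pdV_supp {v : E3 → Fin 2 → ℂ} (j : Fin 3) : tsupport (pdV j v) ⊆ tsupport v :=
  tsupport_fderiv_apply_subset ℝ _

lemma lapV_zero {v : E3 → Fin 2 → ℂ} {x : E3} (hx : x ∉ tsupport v) : lapV v x = 0 := by
  unfold lapV
  apply Finset.sum_eq_zero
  intro j _
  exact image_eq_zero_of_notMem_tsupport (fun h => hx (pdV_supp j (pdV_supp j h)))

lemma pdV_zero {v : E3 → Fin 2 → ℂ} {x : E3} (hx : x ∉ tsupport v) (j : Fin 3) :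
    pdV j v x = 0 :=
  image_eq_zero_of_notMem_tsupport (fun h => hx (pdV_supp j h))

lemma lapV_cont {v : E3 → Fin 2 → ℂ} (hv : ContDiff ℝ (⊤ : ℕ∞) v) : Continuous (lapV v) := by
  unfold lapV
  exact continuous_finsetSum _ fun j _ => (pdV_cd (pdV_cd hv j) j).continuous

lemma lap_clm (L : (Fin 2 → ℂ) →L[ℝ] ℝ) {v : E3 → Fin 2 → ℂ} (hv : ContDiff ℝ (⊤ : ℕ∞) v)
    (x : E3) : lap (fun x => L (v x)) x = L (lapV v x) := by
  have e : ∀ j, pdR j (fun x => L (v x)) = fun x => L (pdV j v x) :=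
    fun j => funext fun x => pdR_clm L (hv.differentiable (by simp)) j x
  unfold lap lapV
  rw [Fin.sum_univ_three, e, e, e, pdR_clm L ((pdV_cd hv 0).differentiable (by simp)),
    pdR_clm L ((pdV_cd hv 1).differentiable (by simp)),
    pdR_clm L ((pdV_cd hv 2).differentiable (by simp)), map_add, map_add]

def Lr (k : Fin 2) : (Fin 2 → ℂ) →L[ℝ] ℝ := Complex.reCLM.comp (ContinuousLinearMap.proj k)
def Li (k : Fin 2) : (Fin 2 → ℂ) →L[ℝ] ℝ := Complex.imCLM.comp (ContinuousLinearMap.proj k)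

lemma nsq (z : Fin 2 → ℂ) (k : Fin 2) : ‖z k‖^2 = (Lr k z)^2 + (Li k z)^2 := by
  rw [← Complex.normSq_eq_norm_sq, Complex.normSq_apply]
  simp [Lr, Li, sq]

lemma comp_supp (L : (Fin 2 → ℂ) →L[ℝ] ℝ) (v : E3 → Fin 2 → ℂ) :
    tsupport (fun x => L (v x)) ⊆ tsupport v :=
  closure_mono (fun x hx h => hx (by simp [h]))

lemma G2_clm (L : (Fin 2 → ℂ) →L[ℝ] ℝ) {v : E3 → Fin 2 → ℂ} (hv : ContDiff ℝ (⊤ : ℕ∞) v)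
    (x : E3) : G2 (fun x => L (v x)) x = ∑ j, (L (pdV j v x))^2 := by
  rw [Fin.sum_univ_three, G2]
  simp only [pdR_clm L (hv.differentiable (by simp))]
  ring

lemma core_s1 (Ω : Set E3) (hΩ : IsOpen Ω) (x₀ : E3) (h ε τ R : ℝ) (hh : 0 < h) (hh1 : h ≤ 1/1000)
    (hε : 0 < ε) (hε1 : ε ≤ 1/9) (hτ : τ = h / ε) (hτ1 : τ ≤ 1) (hR : 4 * R^2 * h * τ ≤ 1)
    (hρ : ∀ x ∈ Ω, 0 < rho x₀ x) (hρR : ∀ x ∈ Ω, rho x₀ x ≤ R)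
    (hF1 : ∀ x ∈ Ω, 1/2 ≤ FF x₀ τ x) (hF2 : ∀ x ∈ Ω, FF x₀ τ x ≤ 2)
    {v : E3 → Fin 2 → ℂ} (hv : ContDiff ℝ (⊤ : ℕ∞) v) (hc : HasCompactSupport v)
    (hs : tsupport v ⊆ Ω) :
    Integrable (fun x => Real.exp (2 * psi x₀ τ h x) * N0 v x) ∧
    Integrable (fun x => Real.exp (2 * psi x₀ τ h x) * N1 v x) ∧
    Integrable (fun x => Real.exp (2 * psi x₀ τ h x) * N2 v x) ∧
    ε⁻¹ * ((h⁻¹)^2 * (∫ x in Ω, Real.exp (2 * psi x₀ τ h x) * N0 v x)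
      + ∫ x in Ω, Real.exp (2 * psi x₀ τ h x) * N1 v x) ≤
    2 * (1 + 4 * R + 4 * R^2) * ∫ x in Ω, Real.exp (2 * psi x₀ τ h x) * N2 v x := by
  have hcont : ContinuousOn (fun x => Real.exp (2 * psi x₀ τ h x)) (tsupport v) := by
    intro x hx
    have := (psi_cd τ h (hρ x (hs hx))).continuousAt
    exact (Real.continuous_exp.continuousAt.comp (this.const_mul 2)).continuousWithinAt
  have hvc := hv.continuous
  have hpc := fun j => (pdV_cd hv j).continuous
  have hlc := lapV_cont hv
  have i0 : Integrable (fun x => Real.exp (2 * psi x₀ τ h x) * N0 v x) := by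
    refine wint hc hcont (by unfold N0; fun_prop) ?_
    intro x hx
    simp [N0, image_eq_zero_of_notMem_tsupport hx]
  have i1 : Integrable (fun x => Real.exp (2 * psi x₀ τ h x) * N1 v x) := by
    refine wint hc hcont ?_ ?_
    · unfold N1
      refine continuous_finsetSum _ fun j _ => continuous_finsetSum _ fun k _ => ?_
      have := hpc j
      fun_prop
    intro x hx
    simp [N1, pdV_zero hx]
  have i2 : Integrable (fun x => Real.exp (2 * psi x₀ τ h x) * N2 v x) := by
    refine wint hc hcont (by unfold N2; fun_prop) ?_
    intro x hx
    simp [N2, lapV_zero hx]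
  refine ⟨i0, i1, i2, ?_⟩
  obtain ⟨K, hK⟩ : ∃ K, K = 1 + 4 * R + 4 * R^2 := ⟨_, rfl⟩
  let Q : ((Fin 2 → ℂ) →L[ℝ] ℝ) → E3 → ℝ := fun L x =>
    ∑ j, pdR j (GG x₀ τ h ε K (WW x₀ τ h (fun x => L (v x))) j) x
  have hcd : ∀ L : (Fin 2 → ℂ) →L[ℝ] ℝ, ContDiff ℝ (⊤ : ℕ∞) (fun x => L (v x)) :=
    fun L => L.contDiff.comp hv
  have hsu : ∀ L : (Fin 2 → ℂ) →L[ℝ] ℝ, ∀ x ∈ tsupport (fun x => L (v x)), 0 < rho x₀ x :=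
    fun L x hx => hρ x (hs (comp_supp L v hx))
  have hQ : ∀ L, Integrable (Q L) ∧ ∫ x in Ω, Q L x = 0 := by
    intro L
    have hw := WW_cd x₀ τ h (hcd L) (hsu L)
    have hsub : tsupport (WW x₀ τ h (fun x => L (v x))) ⊆ tsupport v :=
      (WW_supp x₀ τ h _).trans (comp_supp L v)
    have hg := fun j => GG_cd x₀ τ h ε K hw (fun x hx => hρ x (hs (hsub hx))) j
    have hg2 := fun j => pdR_int (hg j).1
      (hc.mono' (subset_closure.trans ((hg j).2.trans hsub))) j
    refine ⟨integrable_finsetSum _ fun j _ => (hg2 j).1, ?_⟩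
    rw [setIntegral_eq_integral_of_forall_compl_eq_zero]
    · simp only [Q]
      rw [integral_finsetSum _ fun j _ => (hg2 j).1]
      exact Finset.sum_eq_zero fun j _ => (hg2 j).2
    · intro x hx
      refine Finset.sum_eq_zero fun j _ => image_eq_zero_of_notMem_tsupport fun hm => hx ?_
      exact hs (hsub ((hg j).2 (pd_supp j hm)))
  have hpt : ∀ L, ∀ x ∈ Ω, ε⁻¹ * ((h⁻¹)^2 * (Real.exp (2 * psi x₀ τ h x) * (L (v x)) ^ 2)
      + Real.exp (2 * psi x₀ τ h x) * ∑ j, (L (pdV j v x))^2) ≤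
    2 * K * (Real.exp (2 * psi x₀ τ h x) * (L (lapV v x)) ^ 2) + Q L x := by
    intro L x hx
    have := pointwise x₀ h ε τ R hh hh1 hε hε1 hτ hτ1 hR (hcd L) (hsu L) x (hρ x hx) (hρR x hx)
      (hF1 x hx) (hF2 x hx)
    rw [G2_clm L hv, lap_clm L hv, ← hK] at this
    exact this
  have hpt2 : ∀ x ∈ Ω, ε⁻¹ * ((h⁻¹)^2 * (Real.exp (2 * psi x₀ τ h x) * N0 v x)
      + Real.exp (2 * psi x₀ τ h x) * N1 v x) ≤
    2 * K * (Real.exp (2 * psi x₀ τ h x) * N2 v x) +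
      (Q (Lr 0) x + Q (Li 0) x + (Q (Lr 1) x + Q (Li 1) x)) := by
    intro x hx
    have a := hpt (Lr 0) x hx
    have b := hpt (Li 0) x hx
    have c := hpt (Lr 1) x hx
    have d := hpt (Li 1) x hx
    simp only [N0, N1, N2, Fin.sum_univ_two, nsq, Fin.sum_univ_three] at *
    linarith
  have qi : Integrable (fun x => Q (Lr 0) x + Q (Li 0) x + (Q (Lr 1) x + Q (Li 1) x)) :=
    ((hQ (Lr 0)).1.add (hQ (Li 0)).1).add ((hQ (Lr 1)).1.add (hQ (Li 1)).1)
  have hmono := setIntegral_mono_on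
    ((((i0.const_mul ((h⁻¹)^2)).add i1).const_mul ε⁻¹).integrableOn (s := Ω))
    (((i2.const_mul (2 * K)).add qi).integrableOn (s := Ω)) hΩ.measurableSet hpt2
  simp only [Pi.add_apply] at hmono
  rw [integral_const_mul, integral_add (i0.const_mul _).integrableOn i1.integrableOn,
    integral_const_mul, integral_add (i2.const_mul _).integrableOn qi.integrableOn, integral_const_mul] at hmono
  have hz : ∫ x in Ω, (Q (Lr 0) x + Q (Li 0) x + (Q (Lr 1) x + Q (Li 1) x)) = 0 := by
    have q1 : Integrable (fun x => Q (Lr 0) x + Q (Li 0) x) := (hQ (Lr 0)).1.add (hQ (Li 0)).1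
    have q2 : Integrable (fun x => Q (Lr 1) x + Q (Li 1) x) := (hQ (Lr 1)).1.add (hQ (Li 1)).1
    rw [integral_add q1.integrableOn q2.integrableOn,
      integral_add (hQ (Lr 0)).1.integrableOn (hQ (Li 0)).1.integrableOn,
      integral_add (hQ (Lr 1)).1.integrableOn (hQ (Li 1)).1.integrableOn,
      (hQ _).2, (hQ _).2, (hQ _).2, (hQ _).2]
    simp
  rw [← hK]
  have : ∀ a b : ℝ, b = 0 → a + b = a := by intros; simp [*]
  refine hmono.trans (le_of_eq ?_)
  exact this _ _ hz


lemma pauli_bd (a : Fin 3 → ℂ) (B : ℝ) (ha : ∀ j, ‖a j‖ ≤ B) (z : Fin 2 → ℂ) (k : Fin 2) :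
    ‖(pauli a).mulVec z k‖ ≤ 2 * B * (‖z 0‖ + ‖z 1‖) := by
  have hB : 0 ≤ B := (norm_nonneg _).trans (ha 0)
  have h0 := norm_nonneg (z 0)
  have h1 := norm_nonneg (z 1)
  have m : ∀ j i, ‖a j * z i‖ ≤ B * ‖z i‖ := fun j i => by
    rw [norm_mul]; exact mul_le_mul_of_nonneg_right (ha j) (norm_nonneg _)
  have mI : ∀ j i, ‖a j * Complex.I * z i‖ ≤ B * ‖z i‖ := fun j i => by
    rw [norm_mul, norm_mul, Complex.norm_I, mul_one]
    exact mul_le_mul_of_nonneg_right (ha j) (norm_nonneg _)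
  fin_cases k
  · have e : (pauli a).mulVec z 0 = a 2 * z 0 + (a 0 * z 1 - a 1 * Complex.I * z 1) := by
      simp [pauli, σ1, σ2, σ3, Matrix.mulVec, dotProduct, Fin.sum_univ_two]; ring
    simp only [Fin.zero_eta]
    rw [e]
    have := norm_add_le (a 2 * z 0) (a 0 * z 1 - a 1 * Complex.I * z 1)
    have := norm_sub_le (a 0 * z 1) (a 1 * Complex.I * z 1)
    have := m 2 0
    have := m 0 1
    have := mI 1 1
    have := mul_nonneg hB h0
    linarith
  · have e : (pauli a).mulVec z 1 = (a 0 * z 0 + a 1 * Complex.I * z 0) - a 2 * z 1 := by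
      simp [pauli, σ1, σ2, σ3, Matrix.mulVec, dotProduct, Fin.sum_univ_two]; ring
    simp only [Fin.mk_one]
    rw [e]
    have := norm_sub_le (a 0 * z 0 + a 1 * Complex.I * z 0) (a 2 * z 1)
    have := norm_add_le (a 0 * z 0) (a 1 * Complex.I * z 0)
    have := m 2 1
    have := m 0 0
    have := mI 1 0
    have := mul_nonneg hB h1
    linarith

def Wn (v : E3 → Fin 2 → ℂ) (x : E3) : ℝ := (∑ j, ∑ k, ‖pdV j v x k‖) + ∑ k, ‖v x k‖

lemma Wn_sq (v : E3 → Fin 2 → ℂ) (x : E3) : Wn v x ^ 2 ≤ 8 * (N0 v x + N1 v x) := by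
  simp only [Wn, N0, N1, Fin.sum_univ_two, Fin.sum_univ_three]
  generalize ‖pdV 0 v x 0‖ = a
  generalize ‖pdV 0 v x 1‖ = b
  generalize ‖pdV 1 v x 0‖ = c
  generalize ‖pdV 1 v x 1‖ = d
  generalize ‖pdV 2 v x 0‖ = e
  generalize ‖pdV 2 v x 1‖ = f
  generalize ‖v x 0‖ = g
  generalize ‖v x 1‖ = i
  have t : ∀ p q : ℝ, (p + q)^2 ≤ 2 * (p^2 + q^2) := fun p q => by linarith [sq_nonneg (p - q), show (p+q)^2 + (p-q)^2 = 2 * (p^2+q^2) by ring]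
  have e1 := t (a + b + (c + d)) (e + f + (g + i))
  have e2 := t (a + b) (c + d)
  have e3 := t (e + f) (g + i)
  have e4 := t a b
  have e5 := t c d
  have e6 := t e f
  have e7 := t g i
  have : a + b + (c + d) + (e + f) + (g + i) = a + b + (c + d) + (e + f + (g + i)) := by ring
  rw [this]
  linarith

lemma sigmaD_bd (v : E3 → Fin 2 → ℂ) (x : E3) (k : Fin 2) :
    ‖sigmaD v x k‖ ≤ ∑ j, ∑ k, ‖pdV j v x k‖ := by
  have nn := fun j k => norm_nonneg (pdV j v x k)
  simp only [Fin.sum_univ_two, Fin.sum_univ_three]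
  have t := fun a b c : ℂ => (norm_add_le (a + b) c).trans (add_le_add_left (norm_add_le a b) ‖c‖)
  fin_cases k
  · have e : sigmaD v x 0 = (-Complex.I * pdV 0 v x 1) + (- pdV 1 v x 1) + (-Complex.I * pdV 2 v x 0) := by
      simp [sigmaD, σ1, σ2, σ3, Matrix.mulVec, dotProduct, Fin.sum_univ_two]; ring_nf
      simp [Complex.I_sq]
      ring
    have := t (-Complex.I * pdV 0 v x 1) (- pdV 1 v x 1) (-Complex.I * pdV 2 v x 0)
    simp only [norm_mul, norm_neg, Complex.norm_I, one_mul] at this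
    simp only [Fin.zero_eta]
    rw [e]
    linarith [nn 0 0, nn 1 0, nn 2 1]
  · have e : sigmaD v x 1 = (-Complex.I * pdV 0 v x 0) + (pdV 1 v x 0) + (Complex.I * pdV 2 v x 1) := by
      simp [sigmaD, σ1, σ2, σ3, Matrix.mulVec, dotProduct, Fin.sum_univ_two]; ring_nf
      simp [Complex.I_sq]
    have := t (-Complex.I * pdV 0 v x 0) (pdV 1 v x 0) (Complex.I * pdV 2 v x 1)
    simp only [norm_mul, norm_neg, Complex.norm_I, one_mul] at this
    simp only [Fin.mk_one]
    rw [e]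
    linarith [nn 0 1, nn 1 1, nn 2 0]

def ZZ (Ω : Set E3) (A : E3 → Fin 3 → ℝ) (qm : E3 → ℝ) (qt : E3 → ℂ) (α h : ℝ)
    (v : E3 → Fin 2 → ℂ) (x : E3) : Fin 2 → ℂ :=
  - (2 * Complex.I) • (∑ j, ((A x j : ℂ)) • pdV j v x) + qt x • v x
    - Set.indicator (Sset Ω qm α h)
        (fun y => ((qm y : ℂ))⁻¹ •
          (pauli fun j => -Complex.I * ((pdR j qm y : ℝ) : ℂ)).mulVec (sigmaDA A v y)) x

lemma ZZ_bd (Ω : Set E3) (A : E3 → Fin 3 → ℝ) (qm : E3 → ℝ) (qt : E3 → ℂ) (α h B : ℝ)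
    (v : E3 → Fin 2 → ℂ) (x : E3) (hA : ∀ j, ‖A x j‖ ≤ B) (hq : ∀ j, ‖pdR j qm x‖ ≤ B)
    (ht : ‖qt x‖ ≤ B) (k : Fin 2) :
    ‖ZZ Ω A qm qt α h v x k‖ ≤ 4 * B * (1 + 4 * B) * (1 + Real.sqrt (α * |Real.log h|)) * Wn v x := by
  have hB : 0 ≤ B := (norm_nonneg _).trans ht
  set s := Real.sqrt (α * |Real.log h|) with hs
  have hs0 : 0 ≤ s := Real.sqrt_nonneg _
  have nn := fun j k => norm_nonneg (pdV j v x k)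
  have nv := fun k => norm_nonneg (v x k)
  have hW0 : 0 ≤ Wn v x := by unfold Wn; positivity
  have hvk : ‖v x k‖ ≤ ∑ k, ‖v x k‖ :=
    Finset.single_le_sum (f := fun k => ‖v x k‖) (fun i _ => nv i) (Finset.mem_univ k)
  have hpk : ∑ j, ‖pdV j v x k‖ ≤ ∑ j, ∑ k, ‖pdV j v x k‖ :=
    Finset.sum_le_sum fun j _ =>
      Finset.single_le_sum (f := fun k => ‖pdV j v x k‖) (fun i _ => nn j i) (Finset.mem_univ k)
  have hp0 : 0 ≤ ∑ j, ∑ k, ‖pdV j v x k‖ := by positivity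
  have hv0 : 0 ≤ ∑ k, ‖v x k‖ := by positivity
  have b1 : ‖(- (2 * Complex.I) • (∑ j, ((A x j : ℂ)) • pdV j v x)) k‖ ≤
      2 * B * ∑ j, ∑ k, ‖pdV j v x k‖ := by
    simp only [Pi.smul_apply, Finset.sum_apply, smul_eq_mul, norm_mul, norm_neg, Complex.norm_I,
      Complex.norm_ofNat, mul_one]
    rw [mul_assoc]
    apply mul_le_mul_of_nonneg_left _ (by norm_num)
    refine (norm_sum_le _ _).trans ?_
    refine le_trans ?_ (mul_le_mul_of_nonneg_left hpk hB)
    rw [Finset.mul_sum]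
    refine Finset.sum_le_sum fun j _ => ?_
    rw [norm_mul, Complex.norm_real]
    exact mul_le_mul_of_nonneg_right (hA j) (norm_nonneg _)
  have b2 : ‖(qt x • v x) k‖ ≤ B * ∑ k, ‖v x k‖ := by
    simp only [Pi.smul_apply, smul_eq_mul, norm_mul]
    exact mul_le_mul ht hvk (norm_nonneg _) hB
  have b3 : ∀ k, ‖sigmaDA A v x k‖ ≤ (1 + 2 * B) * Wn v x := by
    intro k
    have h1 := sigmaD_bd v x k
    have h2 := pauli_bd (fun j => (A x j : ℂ)) B (fun j => by
      rw [Complex.norm_real]; exact hA j) (v x) k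
    have h3 := norm_add_le (sigmaD v x k) ((pauli fun j => (A x j : ℂ)).mulVec (v x) k)
    have h4 : ‖v x 0‖ + ‖v x 1‖ = ∑ k, ‖v x k‖ := by rw [Fin.sum_univ_two]
    rw [h4] at h2
    refine h3.trans ?_
    unfold Wn
    have := mul_nonneg hB hp0
    linarith
  have b4 : ‖Set.indicator (Sset Ω qm α h)
        (fun y => ((qm y : ℂ))⁻¹ •
          (pauli fun j => -Complex.I * ((pdR j qm y : ℝ) : ℂ)).mulVec (sigmaDA A v y)) x k‖ ≤
      s * (4 * B * (1 + 2 * B) * Wn v x) := by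
    by_cases hx : x ∈ Sset Ω qm α h
    · rw [Set.indicator_of_mem hx]
      simp only [Pi.smul_apply, smul_eq_mul, norm_mul]
      have h1 := pauli_bd (fun j => -Complex.I * ((pdR j qm x : ℝ) : ℂ)) B (fun j => by
        rw [norm_mul, norm_neg, Complex.norm_I, one_mul, Complex.norm_real]; exact hq j)
        (sigmaDA A v x) k
      have h2 : 2 * B * (‖sigmaDA A v x 0‖ + ‖sigmaDA A v x 1‖) ≤
          2 * B * ((1 + 2 * B) * Wn v x + (1 + 2 * B) * Wn v x) :=
        mul_le_mul_of_nonneg_left (add_le_add (b3 0) (b3 1)) (by positivity)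
      have h3 : ‖((qm x : ℂ))⁻¹‖ ≤ s := by
        have h5 := hx.2
        rw [← hs] at h5
        have h6 : 0 < |qm x| := by
          by_contra hn
          have : |qm x| = 0 := le_antisymm (not_lt.1 hn) (abs_nonneg _)
          rw [this] at h5; norm_num at h5
        rw [norm_inv, Complex.norm_real, Real.norm_eq_abs, inv_le_iff_one_le_mul₀ h6]
        linarith
      refine mul_le_mul h3 (h1.trans (h2.trans (le_of_eq (by ring)))) (norm_nonneg _) hs0
    · rw [Set.indicator_of_notMem hx]
      simp only [Pi.zero_apply, norm_zero]
      positivity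
  have h5 := norm_sub_le ((- (2 * Complex.I) • (∑ j, ((A x j : ℂ)) • pdV j v x)) k + (qt x • v x) k)
    (Set.indicator (Sset Ω qm α h)
        (fun y => ((qm y : ℂ))⁻¹ •
          (pauli fun j => -Complex.I * ((pdR j qm y : ℝ) : ℂ)).mulVec (sigmaDA A v y)) x k)
  have h6 := norm_add_le ((- (2 * Complex.I) • (∑ j, ((A x j : ℂ)) • pdV j v x)) k) ((qt x • v x) k)
  refine h5.trans ?_
  have h7 : 2 * B * ∑ j, ∑ k, ‖pdV j v x k‖ + B * ∑ k, ‖v x k‖ ≤ 2 * B * Wn v x := by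
    unfold Wn; linarith [mul_nonneg hB hv0]
  have p1 : 0 ≤ B * Wn v x := by positivity
  have p2 : 0 ≤ B * B * Wn v x := by positivity
  have p3 : 0 ≤ s * (B * B * Wn v x) := by positivity
  have p4 : 0 ≤ s * (B * Wn v x) := by positivity
  linarith

lemma Lop_eq (Ω : Set E3) (A : E3 → Fin 3 → ℝ) (qm : E3 → ℝ) (qt : E3 → ℂ) (α h : ℝ)
    (v : E3 → Fin 2 → ℂ) (x : E3) :
    Lop Ω A qm qt α h v x = - lapV v x + ZZ Ω A qm qt α h v x := by
  unfold Lop ZZ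
  module

lemma Lop_bd (Ω : Set E3) (A : E3 → Fin 3 → ℝ) (qm : E3 → ℝ) (qt : E3 → ℂ) (α h B : ℝ)
    (hα : 0 ≤ α)
    (v : E3 → Fin 2 → ℂ) (x : E3) (hA : ∀ j, ‖A x j‖ ≤ B) (hq : ∀ j, ‖pdR j qm x‖ ≤ B)
    (ht : ‖qt x‖ ≤ B) :
    N2 v x ≤ 2 * (∑ k, ‖Lop Ω A qm qt α h v x k‖^2) + 1024 * B^2 * (1 + 4 * B)^2
      * (1 + α * |Real.log h|) * (N0 v x + N1 v x) ∧
    (∑ k, ‖Lop Ω A qm qt α h v x k‖^2) ≤ 2 * N2 v x + 1024 * B^2 * (1 + 4 * B)^2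
      * (1 + α * |Real.log h|) * (N0 v x + N1 v x) := by
  have hl : 0 ≤ α * |Real.log h| := by positivity
  have hB : 0 ≤ B := (norm_nonneg _).trans ht
  have hz : ∀ k, ‖ZZ Ω A qm qt α h v x k‖^2 ≤ 256 * B^2 * (1 + 4 * B)^2
      * (1 + α * |Real.log h|) * (N0 v x + N1 v x) := by
    intro k
    have h1 := ZZ_bd Ω A qm qt α h B v x hA hq ht k
    have h2 := pow_le_pow_left₀ (norm_nonneg _) h1 2
    refine h2.trans ?_
    have hs := Real.sq_sqrt hl
    generalize Real.sqrt (α * |Real.log h|) = s at *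
    have h3 : (1 + s)^2 ≤ 2 * (1 + α * |Real.log h|) := by
      rw [← hs]; linarith [sq_nonneg (1 - s), show (1+s)^2 + (1-s)^2 = 2 * (1 + s^2) by ring]
    have h4 : (1 + s)^2 * Wn v x ^ 2 ≤ (2 * (1 + α * |Real.log h|)) * (8 * (N0 v x + N1 v x)) :=
      mul_le_mul h3 (Wn_sq v x) (sq_nonneg _) (by positivity)
    have h5 := mul_le_mul_of_nonneg_left h4 (show 0 ≤ 16 * B^2 * (1 + 4 * B)^2 by positivity)
    calc _ = 16 * B^2 * (1 + 4 * B)^2 * ((1 + s)^2 * Wn v x ^ 2) := by ring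
      _ ≤ _ := h5
      _ = _ := by ring
  have t : ∀ a b : ℂ, ‖a + b‖^2 ≤ 2 * ‖a‖^2 + 2 * ‖b‖^2 := by
    intro a b
    have h1 := pow_le_pow_left₀ (norm_nonneg _) (norm_add_le a b) 2
    linarith [sq_nonneg (‖a‖ - ‖b‖), show (‖a‖+‖b‖)^2 + (‖a‖-‖b‖)^2 = 2 * ‖a‖^2 + 2 * ‖b‖^2 by ring]
  have z0 := hz 0
  have z1 := hz 1
  simp only [N2, Fin.sum_univ_two]
  constructor
  · have e : ∀ k, ‖lapV v x k‖ = ‖Lop Ω A qm qt α h v x k + - ZZ Ω A qm qt α h v x k‖ := by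
      intro k; rw [Lop_eq]; simp
    have t0 := t (Lop Ω A qm qt α h v x 0) (- ZZ Ω A qm qt α h v x 0)
    have t1 := t (Lop Ω A qm qt α h v x 1) (- ZZ Ω A qm qt α h v x 1)
    rw [← e, norm_neg] at t0 t1
    linarith
  · have t0 := t (- lapV v x 0) (ZZ Ω A qm qt α h v x 0)
    have t1 := t (- lapV v x 1) (ZZ Ω A qm qt α h v x 1)
    rw [norm_neg] at t0 t1
    simp only [Lop_eq, Pi.add_apply, Pi.neg_apply]
    linarith

lemma Lop_meas (Ω : Set E3) (hΩ : IsOpen Ω) (A : E3 → Fin 3 → ℝ) (qm : E3 → ℝ) (qt : E3 → ℂ)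
    (α h : ℝ) (hA : Continuous A) (hqm : ContDiff ℝ (⊤ : ℕ∞) qm) (hqt : Continuous qt)
    {v : E3 → Fin 2 → ℂ} (hv : ContDiff ℝ (⊤ : ℕ∞) v) (k : Fin 2) :
    Measurable (fun x => Lop Ω A qm qt α h v x k) := by
  have hS : MeasurableSet (Sset Ω qm α h) := by
    have : Sset Ω qm α h = Ω ∩ {x | 1 ≤ |qm x| * Real.sqrt (α * |Real.log h|)} := rfl
    rw [this]
    apply hΩ.measurableSet.inter
    apply IsClosed.measurableSet
    have := hqm.continuous
    exact isClosed_le (by fun_prop) (by fun_prop)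
  have hvc := hv.continuous
  have hp := fun j => (pdV_cd hv j).continuous
  have hl := lapV_cont hv
  have hqc := hqm.continuous
  have hqd := fun j => (pdR_contDiff hqm j).continuous
  have pc : ∀ a : E3 → Fin 3 → ℂ, (∀ j, Continuous fun x => a x j) →
      Continuous fun x => pauli (a x) := by
    intro a ha
    have := ha 0
    have := ha 1
    have := ha 2
    unfold pauli; fun_prop
  have hsig : Continuous (sigmaDA A v) := by
    have h0 := hp 0
    have h1 := hp 1
    have h2 := hp 2
    unfold sigmaDA sigmaD
    have c1 := (pc (fun x j => (A x j : ℂ)) (fun j => by fun_prop)).matrix_mulVec hvc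
    have d0 := (continuous_const (y := σ1)).matrix_mulVec h0
    have d1 := (continuous_const (y := σ2)).matrix_mulVec h1
    have d2 := (continuous_const (y := σ3)).matrix_mulVec h2
    exact (((d0.add d1).add d2).const_smul (-Complex.I)).add c1
  have hcm : Continuous fun y =>
      (pauli fun j => -Complex.I * ((pdR j qm y : ℝ) : ℂ)).mulVec (sigmaDA A v y) :=
    (pc (fun y j => -Complex.I * ((pdR j qm y : ℝ) : ℂ)) (fun j => by
      have := hqd j; fun_prop)).matrix_mulVec hsig
  have hind : Measurable (Set.indicator (Sset Ω qm α h)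
        (fun y => ((qm y : ℂ))⁻¹ •
          (pauli fun j => -Complex.I * ((pdR j qm y : ℝ) : ℂ)).mulVec (sigmaDA A v y))) := by
    refine Measurable.indicator ?_ hS
    have hi : Measurable (fun y => ((qm y : ℂ))⁻¹) :=
      (Complex.continuous_ofReal.comp hqc).measurable.inv
    exact hi.smul hcm.measurable
  have hsum : Continuous fun x => -lapV v x - (2 * Complex.I) • (∑ j, ((A x j : ℂ)) • pdV j v x)
      + qt x • v x := by
    have : Continuous fun x => ∑ j, ((A x j : ℂ)) • pdV j v x :=
      continuous_finsetSum _ fun j _ => by have := hp j; fun_prop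
    fun_prop
  exact (measurable_pi_apply k).comp (hsum.measurable.sub hind)


lemma small_h (α T : ℝ) (hα : 0 < α) : ∃ h₀ ∈ Set.Ioo (0 : ℝ) 1, ∀ h ∈ Set.Ioc (0 : ℝ) h₀,
    h ≤ 1/1000 ∧ 9 ≤ α * |Real.log h| ∧ T * (h * |Real.log h|) ≤ 1 := by
  have t1 : Filter.Tendsto Real.log (nhdsWithin 0 (Set.Ioi 0)) Filter.atBot :=
    Real.tendsto_log_nhdsNE_zero.mono_left (nhdsWithin_mono _ fun _ h => ne_of_gt h)
  have t2 : Filter.Tendsto (fun x : ℝ => T * |Real.log x * x ^ (1:ℝ)|) (nhdsWithin 0 (Set.Ioi 0))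
      (nhds (T * |0|)) :=
    ((tendsto_log_mul_rpow_nhdsGT_zero one_pos).abs).const_mul T
  have e1 := t1.eventually (Filter.eventually_le_atBot (-(9 / α)))
  rw [abs_zero, mul_zero] at t2
  have e2 := t2.eventually (eventually_le_nhds (show (0:ℝ) < 1 by norm_num))
  obtain ⟨u, hu, hu2⟩ := mem_nhdsGT_iff_exists_Ioc_subset.1 (e1.and e2)
  have hu0 : 0 < u := hu
  refine ⟨min u (1/1000), ⟨by positivity, ?_⟩, ?_⟩
  · exact (min_le_right _ _).trans_lt (by norm_num)
  · rintro h ⟨h0, h1⟩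
    have := hu2 ⟨h0, h1.trans (min_le_left _ _)⟩
    obtain ⟨a, b⟩ := this
    refine ⟨h1.trans (min_le_right _ _), ?_, ?_⟩
    · have : 9 / α ≤ |Real.log h| := by
        have := neg_le_abs (Real.log h)
        linarith
      rw [div_le_iff₀ hα] at this
      linarith
    · rw [Real.rpow_one, abs_mul, abs_of_pos h0] at b
      linarith

lemma dom_bd (Ω : Set E3) (hΩb : Bornology.IsBounded Ω) (x₀ : E3) (hx₀ : x₀ ∉ closure Ω) :
    ∃ R Λ : ℝ, 0 ≤ R ∧ 0 ≤ Λ ∧ ∀ x ∈ Ω, 0 < rho x₀ x ∧ rho x₀ x ≤ R ∧ |ph x₀ x| ≤ Λ := by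
  have : (closure Ω)ᶜ ∈ nhds x₀ := isClosed_closure.isOpen_compl.mem_nhds hx₀
  obtain ⟨δ, hδ, hb⟩ := Metric.mem_nhds_iff.1 this
  obtain ⟨r, hr⟩ := hΩb.subset_closedBall x₀
  refine ⟨r^2, |Real.log δ| + |Real.log r|, by positivity, by positivity, ?_⟩
  intro x hx
  have h1 : ‖x - x₀‖ ≤ r := by
    have := hr hx
    rwa [Metric.mem_closedBall, dist_eq_norm] at this
  have h2 : δ ≤ ‖x - x₀‖ := by
    by_contra hh
    push Not at hh
    have : x ∈ Metric.ball x₀ δ := by rwa [Metric.mem_ball, dist_eq_norm]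
    exact hb this (subset_closure hx)
  have h3 : 0 < ‖x - x₀‖ := hδ.trans_le h2
  refine ⟨by rw [rho_eq]; positivity, by rw [rho_eq]; gcongr, ?_⟩
  rw [ph_eq, abs_le]
  have l1 := Real.log_le_log h3 h1
  have l2 := Real.log_le_log hδ h2
  have := neg_abs_le (Real.log δ)
  have := le_abs_self (Real.log r)
  have := abs_nonneg (Real.log δ)
  have := abs_nonneg (Real.log r)
  constructor <;> linarith

lemma coef_bd (A : E3 → Fin 3 → ℝ) (qm : E3 → ℝ) (qt : E3 → ℂ)
    (hAb : ∀ n : ℕ, ∃ M : ℝ, ∀ x, ‖iteratedFDeriv ℝ n A x‖ ≤ M)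
    (hqmb : ∀ n : ℕ, ∃ M : ℝ, ∀ x, ‖iteratedFDeriv ℝ n qm x‖ ≤ M)
    (hqtb : ∀ n : ℕ, ∃ M : ℝ, ∀ x, ‖iteratedFDeriv ℝ n qt x‖ ≤ M) :
    ∃ B : ℝ, ∀ x, (∀ j, ‖A x j‖ ≤ B) ∧ (∀ j, ‖pdR j qm x‖ ≤ B) ∧ ‖qt x‖ ≤ B := by
  obtain ⟨a, ha⟩ := hAb 0
  obtain ⟨b, hb⟩ := hqmb 1
  obtain ⟨c, hc⟩ := hqtb 0
  refine ⟨max a (max b c), fun x => ⟨fun j => ?_, fun j => ?_, ?_⟩⟩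
  · have := ha x
    rw [norm_iteratedFDeriv_zero] at this
    exact (norm_le_pi_norm _ j).trans (this.trans (le_max_left _ _))
  · have := hb x
    rw [norm_iteratedFDeriv_one] at this
    have h2 := (fderiv ℝ qm x).le_opNorm (EuclideanSpace.single j (1:ℝ))
    rw [EuclideanSpace.norm_single, norm_one, mul_one] at h2
    exact h2.trans (this.trans ((le_max_left _ _).trans (le_max_right _ _)))
  · have := hc x
    rw [norm_iteratedFDeriv_zero] at this
    exact this.trans ((le_max_right _ _).trans (le_max_right _ _))

lemma psi_meas (x₀ : E3) (τ h : ℝ) : Measurable (psi x₀ τ h) := by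
  have : Measurable (ph x₀) := by
    have hc : Continuous (rho x₀) := by unfold rho; fun_prop
    exact (Real.measurable_log.comp hc.measurable).mul_const _
  unfold psi
  fun_prop

lemma fin_arith (h ε ℓ C₀ K M I0 I1 I2 IL : ℝ) (hh : 0 < h) (hh1 : h ≤ 1) (hε : ε⁻¹ = C₀ * ℓ)
    (hℓ : 1 ≤ ℓ) (hK : 0 ≤ K) (hM : 0 ≤ M) (hC : C₀ = 1 + 8 * (K * M)) (h0 : 0 ≤ I0) (h1 : 0 ≤ I1)
    (hc : ε⁻¹ * ((h⁻¹)^2 * I0 + I1) ≤ 2 * K * I2) (hL : I2 ≤ 2 * IL + M * (1 + ℓ) * (I0 + I1)) :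
    (h^2/ε) * (I0 + h^2 * I1) ≤ 8 * K * (h^4 * IL) := by
  have hJ : I0 ≤ (h⁻¹)^2 * I0 := by
    have : 1 ≤ (h⁻¹)^2 := one_le_pow₀ ((one_le_inv₀ hh).2 hh1)
    nlinarith
  have key : ε⁻¹ * ((h⁻¹)^2 * I0 + I1) ≤ 8 * K * IL := by
    set J := (h⁻¹)^2 * I0 with hJd
    have a1 : 2 * K * I2 ≤ 2 * K * (2 * IL + M * (1 + ℓ) * (I0 + I1)) := by gcongr
    have a2 : (K * M) * (1 + ℓ) * (I0 + I1) ≤ (K * M) * (2 * ℓ) * (J + I1) := by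
      have : 0 ≤ K * M := by positivity
      gcongr
      linarith
    have a3 : 4 * (K * M) * ℓ * (J + I1) ≤ (1/2) * (ε⁻¹ * (J + I1)) := by
      rw [hε, hC]
      have : 0 ≤ ℓ * (J + I1) := by
        apply mul_nonneg <;> linarith
      nlinarith
    linarith
  have e : (h^2/ε) * (I0 + h^2 * I1) = h^4 * (ε⁻¹ * ((h⁻¹)^2 * I0 + I1)) := by
    field_simp
  rw [e]
  have : 0 ≤ h^4 := by positivity
  nlinarith

/-- Carleman estimate for a second-order operator with `h`-dependent
singular lower-order coefficients (interior version):
`(h²/ε(h)) (∫ e^{2φ̃/h}|v|² + ∫ e^{2φ̃/h}|h∇v|²) ≤ C ∫ e^{2φ̃/h} h⁴ |Lv|²` for all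
`v ∈ C_c^∞(Ω; ℂ²)`. -/
theorem second_order_carleman_estimate
    (Ω : Set E3) (hΩo : IsOpen Ω) (hΩb : Bornology.IsBounded Ω)
    (x₀ : E3) (hx₀ : x₀ ∉ closure Ω)
    (A : E3 → Fin 3 → ℝ) (qm : E3 → ℝ) (qt : E3 → ℂ)
    (hA : ContDiff ℝ (⊤ : ℕ∞) A) (hAb : ∀ n : ℕ, ∃ M : ℝ, ∀ x, ‖iteratedFDeriv ℝ n A x‖ ≤ M)
    (hqm : ContDiff ℝ (⊤ : ℕ∞) qm) (hqmb : ∀ n : ℕ, ∃ M : ℝ, ∀ x, ‖iteratedFDeriv ℝ n qm x‖ ≤ M)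
    (hqt : ContDiff ℝ (⊤ : ℕ∞) qt) (hqtb : ∀ n : ℕ, ∃ M : ℝ, ∀ x, ‖iteratedFDeriv ℝ n qt x‖ ≤ M) :
    ∃ C₀ C : ℝ, 1 ≤ C₀ ∧ 0 < C ∧
      ∀ α ∈ Set.Ioo (0 : ℝ) 1, ∃ h₀ ∈ Set.Ioo (0 : ℝ) 1, ∀ h ∈ Set.Ioc (0 : ℝ) h₀,
        ∀ v : E3 → Fin 2 → ℂ,
          ContDiff ℝ (⊤ : ℕ∞) v → HasCompactSupport v → tsupport v ⊆ Ω →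
          (h ^ 2 / carlEps C₀ α h) *
              ((∫ x in Ω, Real.exp (2 * carlPhiT x₀ C₀ α h x / h) * ∑ k, ‖v x k‖ ^ 2)
                + ∫ x in Ω, Real.exp (2 * carlPhiT x₀ C₀ α h x / h) *
                    ∑ j, ∑ k, ‖h • pdV j v x k‖ ^ 2)
            ≤ C * ∫ x in Ω, Real.exp (2 * carlPhiT x₀ C₀ α h x / h) *
                (h ^ 4 * ∑ k, ‖Lop Ω A qm qt α h v x k‖ ^ 2) := by

  obtain ⟨R, Λ, hR0, hΛ0, hdom⟩ := dom_bd Ω hΩb x₀ hx₀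
  obtain ⟨B, hB⟩ := coef_bd A qm qt hAb hqmb hqtb
  have hB0 : 0 ≤ B := (norm_nonneg _).trans (hB x₀).2.2
  obtain ⟨K, hK⟩ : ∃ K, K = 1 + 4 * R + 4 * R^2 := ⟨_, rfl⟩
  obtain ⟨M, hM⟩ : ∃ M, M = 1024 * B^2 * (1 + 4 * B)^2 := ⟨_, rfl⟩
  have hKpos : 0 < K := by rw [hK]; positivity
  have hM0 : 0 ≤ M := by rw [hM]; positivity
  obtain ⟨C₀, hC₀⟩ : ∃ C₀, C₀ = 1 + 8 * (K * M) := ⟨_, rfl⟩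
  have hC1 : 1 ≤ C₀ := by
    have : 0 ≤ K * M := by positivity
    linarith
  refine ⟨C₀, 8 * K, hC1, by positivity, ?_⟩
  rintro α ⟨hα0, hα1⟩
  obtain ⟨h₀, hh₀, hsm⟩ := small_h α (C₀ * (1 + 2 * Λ + 4 * R^2)) hα0
  refine ⟨h₀, hh₀, ?_⟩
  intro h hh v hv hc hs
  obtain ⟨hle, hℓ9, hT⟩ := hsm h hh
  have hpos : 0 < h := hh.1
  obtain ⟨ℓ, hℓ⟩ : ∃ ℓ, ℓ = α * |Real.log h| := ⟨_, rfl⟩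
  rw [← hℓ] at hℓ9
  obtain ⟨ε, hε⟩ : ∃ ε, ε = carlEps C₀ α h := ⟨_, rfl⟩
  have hεi : ε⁻¹ = C₀ * ℓ := by rw [hε, carlEps, inv_inv, hℓ]; ring
  have hεpos : 0 < ε := by
    rw [← inv_pos, hεi]; positivity
  have hε9 : ε ≤ 1/9 := by
    have : 9 ≤ ε⁻¹ := by rw [hεi]; nlinarith
    rw [le_div_iff₀ (by norm_num)]
    have := mul_le_mul_of_nonneg_left this hεpos.le
    rwa [mul_inv_cancel₀ hεpos.ne'] at this
  obtain ⟨τ, hτ⟩ : ∃ τ, τ = h / ε := ⟨_, rfl⟩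
  have hτ0 : 0 ≤ τ := by rw [hτ]; positivity
  have hτb : τ * (1 + 2 * Λ + 4 * R^2) ≤ 1 := by
    refine le_trans ?_ hT
    have : τ ≤ C₀ * (h * |Real.log h|) := by
      rw [hτ, div_eq_mul_inv, hεi, hℓ]
      have : α * |Real.log h| ≤ 1 * |Real.log h| := by gcongr
      calc h * (C₀ * (α * |Real.log h|)) ≤ h * (C₀ * (1 * |Real.log h|)) := by gcongr
        _ = _ := by ring
    calc τ * (1 + 2 * Λ + 4 * R^2) ≤ (C₀ * (h * |Real.log h|)) * (1 + 2 * Λ + 4 * R^2) := by gcongr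
      _ = _ := by ring
  have hτΛ : 0 ≤ τ * Λ := by positivity
  have hτR : 0 ≤ τ * R^2 := by positivity
  have hF : ∀ x ∈ Ω, |τ * ph x₀ x| ≤ 1/2 := by
    intro x hx
    rw [abs_mul, abs_of_nonneg hτ0]
    have := mul_le_mul_of_nonneg_left (hdom x hx).2.2 hτ0
    linarith
  obtain ⟨i0, i1, i2, hcore⟩ := core_s1 Ω hΩo x₀ h ε τ R hpos hle hεpos hε9 hτ (by linarith)
    (by
      have : h * (τ * R^2) ≤ 1 * (τ * R^2) := by gcongr; linarith
      linarith)
    (fun x hx => (hdom x hx).1) (fun x hx => (hdom x hx).2.1)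
    (fun x hx => by have := (abs_le.1 (hF x hx)).1; unfold FF; linarith)
    (fun x hx => by have := (abs_le.1 (hF x hx)).2; unfold FF; linarith) hv hc hs
  have hb := fun x => Lop_bd Ω A qm qt α h B hα0.le v x (hB x).1 (hB x).2.1 (hB x).2.2
  rw [← hM, ← hℓ] at hb
  have iL : Integrable (fun x => Real.exp (2 * psi x₀ τ h x)
      * ∑ k, ‖Lop Ω A qm qt α h v x k‖ ^ 2) := by
    refine Integrable.mono' ((i2.const_mul 2).add ((i0.add i1).const_mul (M * (1 + ℓ)))) ?_ ?_
    · have m1 := psi_meas x₀ τ h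
      have m2 := fun k => Lop_meas Ω hΩo A qm qt α h hA.continuous hqm hqt.continuous hv k
      have m3 : Measurable (fun x => ∑ k, ‖Lop Ω A qm qt α h v x k‖ ^ 2) :=
        Finset.measurable_sum _ fun k _ => (m2 k).norm.pow_const 2
      exact (((Real.measurable_exp.comp (m1.const_mul 2))).mul m3).aestronglyMeasurable
    · refine Filter.Eventually.of_forall fun x => ?_
      have e := Real.exp_pos (2 * psi x₀ τ h x)
      rw [Real.norm_of_nonneg (by positivity)]
      have := mul_le_mul_of_nonneg_left (hb x).2 e.le
      simp only [Pi.add_apply]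
      linarith
  have hI2 : (∫ x in Ω, Real.exp (2 * psi x₀ τ h x) * N2 v x) ≤
      2 * (∫ x in Ω, Real.exp (2 * psi x₀ τ h x) * ∑ k, ‖Lop Ω A qm qt α h v x k‖ ^ 2)
      + M * (1 + ℓ) * ((∫ x in Ω, Real.exp (2 * psi x₀ τ h x) * N0 v x)
        + ∫ x in Ω, Real.exp (2 * psi x₀ τ h x) * N1 v x) := by
    have j0 := i0.integrableOn (s := Ω)
    have j1 := i1.integrableOn (s := Ω)
    have jL := iL.integrableOn (s := Ω)
    have jS : IntegrableOn (fun a => M * (1 + ℓ) * (Real.exp (2 * psi x₀ τ h a) * N0 v a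
        + Real.exp (2 * psi x₀ τ h a) * N1 v a)) Ω volume := (j0.add j1).const_mul (M * (1 + ℓ))
    have jL2 : IntegrableOn (fun a => 2 * (Real.exp (2 * psi x₀ τ h a)
        * ∑ k, ‖Lop Ω A qm qt α h v a k‖ ^ 2)) Ω volume := jL.const_mul 2
    rw [← integral_add j0 j1, ← integral_const_mul, ← integral_const_mul,
      ← integral_add jL2 jS]
    refine setIntegral_mono i2.integrableOn (jL2.add jS) fun x => ?_
    have e := Real.exp_pos (2 * psi x₀ τ h x)
    have := mul_le_mul_of_nonneg_left (hb x).1 e.le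
    simp only [Pi.add_apply]
    linarith
  have hex : ∀ x, 2 * carlPhiT x₀ C₀ α h x / h = 2 * psi x₀ τ h x := by
    intro x
    rw [carlPhiT, ← hε, ← hτ, psi, ph_eq]
    field_simp
  have hp0 : 0 ≤ ∫ x in Ω, Real.exp (2 * psi x₀ τ h x) * N0 v x :=
    integral_nonneg fun x => by unfold N0; positivity
  have hp1 : 0 ≤ ∫ x in Ω, Real.exp (2 * psi x₀ τ h x) * N1 v x :=
    integral_nonneg fun x => by unfold N1; positivity
  have g1 : ∀ x, Real.exp (2 * psi x₀ τ h x) * ∑ j, ∑ k, ‖h • pdV j v x k‖ ^ 2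
      = h^2 * (Real.exp (2 * psi x₀ τ h x) * N1 v x) := by
    intro x
    have : ∑ j, ∑ k, ‖h • pdV j v x k‖ ^ 2 = h^2 * N1 v x := by
      simp only [N1, Finset.mul_sum, norm_smul, mul_pow, Real.norm_of_nonneg hpos.le]
    rw [this]; ring
  have g2 : ∀ x, Real.exp (2 * psi x₀ τ h x) * (h ^ 4 * ∑ k, ‖Lop Ω A qm qt α h v x k‖ ^ 2)
      = h^4 * (Real.exp (2 * psi x₀ τ h x) * ∑ k, ‖Lop Ω A qm qt α h v x k‖ ^ 2) := by
    intro x; ring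
  simp only [hex, g1, g2]
  rw [integral_const_mul, integral_const_mul, ← hε]
  rw [← hK] at hcore
  exact fin_arith h ε ℓ C₀ K M _ _ _ _ hpos (by linarith) hεi (by linarith) hKpos.le hM0 hC₀
    hp0 hp1 hcore hI2
end
end
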